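/- arXiv:2112.11144 — 3 statements merged into one kernel-verified Lean document; each statement's English description precedes it below -/
import Mathlib

section
/- Let a, b be positive integers and write n = p(a+b+1) + q with p ≥ 0 and 0 ≤ q ≤ a+b. Then for every integer k ≥ 3, ex(n, K_k, S_{a,b}) = p·C(a+b+1, k) + C(q, k), where C(x,y) denotes the binomial coefficient. -/
open SimpleGraph

/-- The number of subgraphs of `G` isomorphic to `H`. -/
noncomputable def copyCount {α β : Type*} (H : SimpleGraph α) (G : SimpleGraph β) : ℕ :=
  Set.ncard {G' : G.Subgraph | Nonempty (H ≃g G'.coe)}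

/-- `G` contains a subgraph isomorphic to `F`. -/
def Contains {α β : Type*} (F : SimpleGraph α) (G : SimpleGraph β) : Prop :=
  ∃ f : F →g G, Function.Injective f

/-- The generalized Turán number `ex(n, H, F)`: the maximum number of subgraphs
isomorphic to `H` in an `F`-free graph on `n` vertices. -/
noncomputable def exGen {α β : Type*} (n : ℕ) (H : SimpleGraph α) (F : SimpleGraph β) : ℕ :=
  sSup {N | ∃ G : SimpleGraph (Fin n), ¬ Contains F G ∧ N = copyCount H G}

/-- The double star `S_{a,b}`: central edge `0-1`, vertices `2,…,a+1` are leaves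
attached to `0`, and vertices `a+2,…,a+b+1` are leaves attached to `1`. -/
def doubleStar (a b : ℕ) : SimpleGraph (Fin (a + b + 2)) :=
  SimpleGraph.fromRel (fun x y =>
    (x.val = 0 ∧ y.val = 1) ∨ (x.val = 0 ∧ 2 ≤ y.val ∧ y.val < a + 2) ∨
      (x.val = 1 ∧ a + 2 ≤ y.val))

namespace DoubleStarCliques

open Finset

open scoped Classical in
/-- The `k`-cliques of `G` contained in `U`. -/
noncomputable def cliquesIn {V : Type*} (G : SimpleGraph V) (k : ℕ) (U : Finset V) :
    Finset (Finset V) :=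
  (U.powersetCard k).filter fun K => G.IsClique (K : Set V)

open scoped Classical in
/-- The neighbours of `v` in `U`. -/
noncomputable def nbrsIn {V : Type*} (G : SimpleGraph V) (U : Finset V) (v : V) : Finset V :=
  U.filter (G.Adj v)

/-- The number of `k`-sets inside the blocks when `n` points are cut greedily into blocks of
size `m`. -/
def blockCount (m k n : ℕ) : ℕ := n / m * m.choose k + (n % m).choose k

section Arithmetic

lemma choose_add_choose_le (k x y z : ℕ) :
    (x + y).choose k + (x + z).choose k ≤ (x + y + z).choose k + x.choose k := by
  induction y with
  | zero => simp [add_comm]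
  | succ y ih =>
    cases k with
    | zero => simp
    | succ k =>
      have h : (x + y).choose k ≤ (x + y + z).choose k := Nat.choose_le_choose k (by omega)
      have h1 := Nat.choose_succ_succ' (x + y) k
      have h2 := Nat.choose_succ_succ' (x + y + z) k
      have e : x + (y + 1) + z = x + y + z + 1 := by omega
      rw [e, h2, ← add_assoc x y 1, h1]
      omega

lemma choose_add_blockCount_le {m k s : ℕ} (hk : 0 < k) (hm : 0 < m) (hs : s ≤ m) (n : ℕ) :
    s.choose k + blockCount m k n ≤ blockCount m k (n + s) := by
  have hq : n % m < m := Nat.mod_lt _ hm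
  have hn := Nat.div_add_mod n m
  unfold blockCount
  generalize n / m = p at *
  generalize n % m = q at *
  subst hn
  rcases lt_or_ge (q + s) m with h | h
  · have e : m * p + q + s = q + s + m * p := by ring
    rw [e, Nat.add_mul_div_left _ _ hm, Nat.add_mul_mod_self_left, Nat.div_eq_of_lt h,
      Nat.mod_eq_of_lt h]
    have := choose_add_choose_le k 0 q s
    simp only [zero_add, Nat.choose_eq_zero_of_lt hk] at this ⊢
    omega
  · obtain ⟨r, hr⟩ := Nat.exists_eq_add_of_le h
    have hrq : r ≤ q := by omega
    have e : m * p + q + s = r + m * (p + 1) := by rw [mul_add]; omega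
    rcases eq_or_lt_of_le (show r ≤ m by omega) with h' | h'
    · omega
    rw [e, Nat.add_mul_div_left _ _ hm, Nat.add_mul_mod_self_left, Nat.div_eq_of_lt h',
      Nat.mod_eq_of_lt h']
    have := choose_add_choose_le k r (q - r) (s - r)
    rw [show r + (q - r) = q by omega, show r + (s - r) = s by omega,
      show q + (s - r) = m by omega] at this
    simp only [zero_add, add_mul, one_mul]
    omega

lemma succ_mul_choose_le_choose_two_mul (c j : ℕ) :
    (j + 1) * c.choose j ≤ (2 * c).choose j := by
  rw [two_mul, Nat.add_choose_eq, ← Finset.Nat.card_antidiagonal j, ← smul_eq_mul]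
  refine Finset.card_nsmul_le_sum _ _ _ fun ij hij => ?_
  rw [HasAntidiagonal.mem_antidiagonal] at hij
  rcases lt_or_ge c j with h | h
  · simp [Nat.choose_eq_zero_of_lt h]
  have hi : ij.1 ≤ j := by omega
  have h1 := Nat.choose_mul (n := c) hi
  have h2 : (c - ij.1).choose (j - ij.1) ≤ c.choose ij.2 := by
    rw [show j - ij.1 = ij.2 by omega]
    exact Nat.choose_le_choose _ (Nat.sub_le _ _)
  calc c.choose j ≤ c.choose j * j.choose ij.1 :=
        Nat.le_mul_of_pos_right _ (Nat.choose_pos hi)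
    _ = c.choose ij.1 * (c - ij.1).choose (j - ij.1) := h1
    _ ≤ _ := Nat.mul_le_mul_left _ h2

lemma mul_choose_le_choose {a b c : ℕ} (h : 2 * c ≤ a + b) (j : ℕ) :
    (a + b + 1) * c.choose j ≤ (a + b + 1).choose (j + 1) := by
  refine Nat.le_of_mul_le_mul_left ?_ (Nat.succ_pos j)
  have h1 := succ_mul_choose_le_choose_two_mul c j
  have h2 : (2 * c).choose j ≤ (a + b).choose j := Nat.choose_le_choose j h
  have h3 := Nat.add_one_mul_choose_eq (a + b) j
  calc (j + 1) * ((a + b + 1) * c.choose j) = (a + b + 1) * ((j + 1) * c.choose j) := by ring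
    _ ≤ (a + b + 1) * (a + b).choose j := Nat.mul_le_mul_left _ (h1.trans h2)
    _ = (j + 1) * (a + b + 1).choose (j + 1) := by rw [h3]; ring

end Arithmetic

section Counting

open scoped Classical

variable {V : Type*} (G : SimpleGraph V)

lemma mem_cliquesIn {k : ℕ} {U K : Finset V} :
    K ∈ cliquesIn G k U ↔ K ⊆ U ∧ K.card = k ∧ G.IsClique (K : Set V) := by
  simp [cliquesIn, mem_powersetCard, and_assoc]

lemma mem_nbrsIn {U : Finset V} {v x : V} : x ∈ nbrsIn G U v ↔ x ∈ U ∧ G.Adj v x := by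
  simp [nbrsIn]

lemma card_cliquesIn_containing_le (j : ℕ) (U : Finset V) (v : V) :
    ((cliquesIn G (j + 1) U).filter (v ∈ ·)).card ≤ (nbrsIn G U v).card.choose j := by
  rw [← card_powersetCard]
  refine card_le_card_of_injOn (fun K => K.erase v) ?_ ?_
  · intro K hK
    simp only [coe_filter, Set.mem_ofPred_eq, mem_cliquesIn] at hK
    obtain ⟨⟨hU, hc, hK⟩, hv⟩ := hK
    simp only [mem_coe, mem_powersetCard, card_erase_of_mem hv, hc, Nat.add_sub_cancel, and_true]
    intro x hx
    rw [mem_erase] at hx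
    exact (mem_nbrsIn G).2 ⟨hU hx.2, hK hv hx.2 hx.1.symm⟩
  · intro K hK L hL h
    simp only [coe_filter, Set.mem_ofPred_eq] at hK hL
    exact erase_injOn' v hK.2 hL.2 h

/-- In a set `W` of at least four vertices, the vertices attached to a clique on the rest of `W`
are at most as many as the vertices joined to all of `W`. -/
lemma card_attached_le_card_dominating (W : Finset V) (hW : 4 ≤ W.card) :
    (W.filter fun z => G.IsClique (W.erase z : Set V) ∧ ∃ x ∈ W, G.Adj z x).card ≤
      (W.filter fun v => ∀ x ∈ W, x ≠ v → G.Adj v x).card := by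
  by_cases hsub : ∀ z ∈ W, G.IsClique (W.erase z : Set V) → ∀ x ∈ W, x ≠ z → G.Adj z x
  · refine card_le_card fun z hz => ?_
    rw [mem_filter] at hz ⊢
    exact ⟨hz.1, hsub z hz.1 hz.2.1⟩
  push Not at hsub
  obtain ⟨z, hz, hcl, w, hw, hwz, hna⟩ := hsub
  have adj_of {t x y : V} (ht : G.IsClique (W.erase t : Set V)) (hx : x ∈ W) (hy : y ∈ W)
      (hxt : x ≠ t) (hyt : y ≠ t) (hxy : x ≠ y) : G.Adj x y :=
    ht (by simp [hx, hxt]) (by simp [hy, hyt]) hxy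
  have hA : (W.filter fun z => G.IsClique (W.erase z : Set V) ∧ ∃ x ∈ W, G.Adj z x) ⊆ {z, w} := by
    intro t ht
    rw [mem_filter] at ht
    by_contra hcon
    simp only [mem_insert, mem_singleton, not_or] at hcon
    exact hna (adj_of ht.2.1 hz hw (Ne.symm hcon.1) (Ne.symm hcon.2) hwz.symm)
  by_cases hwcl : G.IsClique (W.erase w : Set V)
  · have hB : (W.erase z).erase w ⊆ W.filter fun v => ∀ x ∈ W, x ≠ v → G.Adj v x := by
      intro v hv
      simp only [mem_erase] at hv
      obtain ⟨hvw, hvz, hvW⟩ := hv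
      rw [mem_filter]
      refine ⟨hvW, fun x hx hxv => ?_⟩
      by_cases hxz : x = z
      · subst hxz
        exact adj_of hwcl hvW hx hvw hwz.symm hxv.symm
      · exact adj_of hcl hvW hx hvz hxz hxv.symm
    have h1 := card_le_card hA
    have h2 := card_le_card hB
    rw [card_erase_of_mem (mem_erase.2 ⟨hwz, hw⟩), card_erase_of_mem hz] at h2
    have h3 : ({z, w} : Finset V).card ≤ 2 := card_le_two
    omega
  · rcases eq_empty_or_nonempty
      (W.filter fun z => G.IsClique (W.erase z : Set V) ∧ ∃ x ∈ W, G.Adj z x) with h | ⟨t, ht⟩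
    · rw [h]; simp
    have htz : ∀ t ∈ W.filter fun z => G.IsClique (W.erase z : Set V) ∧ ∃ x ∈ W, G.Adj z x,
        t = z := by
      intro t ht
      have h := hA ht
      simp only [mem_insert, mem_singleton] at h
      rcases h with h | h
      · exact h
      · subst h
        exact absurd (mem_filter.1 ht).2.1 hwcl
    obtain rfl := htz t ht
    obtain ⟨v, hv, htv⟩ := (mem_filter.1 ht).2.2
    refine (card_le_one.2 fun x hx y hy => (htz x hx).trans (htz y hy).symm).trans
      (card_pos.2 ⟨v, mem_filter.2 ⟨hv, fun x hx hxv => ?_⟩⟩)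
    by_cases hxt : x = t
    · subst hxt
      exact htv.symm
    · exact adj_of hcl hv hx htv.ne' hxt hxv.symm

lemma sum_card_attached_le {k : ℕ} (hk : 3 ≤ k) (U : Finset V) :
    ∑ v ∈ U, ((cliquesIn G k U).filter fun K => v ∉ K ∧ ∃ x ∈ K, G.Adj v x).card ≤
      ∑ v ∈ U, (nbrsIn G U v).card.choose k := by
  have h1 : ∀ v ∈ U, ((cliquesIn G k U).filter fun K => v ∉ K ∧ ∃ x ∈ K, G.Adj v x).card ≤
      ((U.powersetCard (k + 1)).filter fun W =>
        v ∈ W ∧ G.IsClique (W.erase v : Set V) ∧ ∃ x ∈ W, G.Adj v x).card := by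
    intro v hv
    refine card_le_card_of_injOn (fun K => insert v K) ?_ ?_
    · intro K hK
      simp only [coe_filter, Set.mem_ofPred_eq, mem_cliquesIn] at hK
      obtain ⟨⟨hU, hc, hK⟩, hvK, x, hx, hvx⟩ := hK
      simp only [coe_filter, Set.mem_ofPred_eq, mem_powersetCard]
      refine ⟨⟨insert_subset hv hU, by rw [card_insert_of_notMem hvK, hc]⟩, mem_insert_self _ _,
        ?_, x, mem_insert_of_mem hx, hvx⟩
      rwa [erase_insert hvK]
    · intro K hK L hL h
      simp only [coe_filter, Set.mem_ofPred_eq] at hK hL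
      have := congrArg (fun S => S.erase v) h
      simpa [erase_insert hK.2.1, erase_insert hL.2.1] using this
  have h2 : ∀ v ∈ U, ((U.powersetCard (k + 1)).filter fun W =>
        v ∈ W ∧ ∀ x ∈ W, x ≠ v → G.Adj v x).card ≤ (nbrsIn G U v).card.choose k := by
    intro v _
    rw [← card_powersetCard]
    refine card_le_card_of_injOn (fun W => W.erase v) ?_ ?_
    · intro W hW
      simp only [coe_filter, Set.mem_ofPred_eq, mem_powersetCard] at hW
      obtain ⟨⟨hU, hc⟩, hv, hadj⟩ := hW
      simp only [mem_coe, mem_powersetCard, card_erase_of_mem hv, hc, Nat.add_sub_cancel, and_true]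
      intro x hx
      rw [mem_erase] at hx
      exact (mem_nbrsIn G).2 ⟨hU hx.2, hadj x hx.2 hx.1⟩
    · intro K hK L hL h
      simp only [coe_filter, Set.mem_ofPred_eq] at hK hL
      exact erase_injOn' v hK.2.1 hL.2.1 h
  refine (sum_le_sum h1).trans (le_trans ?_ (sum_le_sum h2))
  have swap (P : V → Finset V → Prop) [∀ v W, Decidable (P v W)] :
      ∑ v ∈ U, ((U.powersetCard (k + 1)).filter fun W => v ∈ W ∧ P v W).card =
        ∑ W ∈ U.powersetCard (k + 1), (W.filter fun v => P v W).card := by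
    have := sum_card_bipartiteAbove_eq_sum_card_bipartiteBelow (s := U)
      (t := U.powersetCard (k + 1)) (fun v W => v ∈ W ∧ P v W)
    simp only [bipartiteAbove, bipartiteBelow] at this
    rw [this]
    refine sum_congr rfl fun W hW => congrArg card ?_
    ext v
    simp only [mem_filter]
    exact ⟨fun h => h.2, fun h => ⟨(mem_powersetCard.1 hW).1 h.1, h⟩⟩
  rw [swap fun v W => G.IsClique (W.erase v : Set V) ∧ ∃ x ∈ W, G.Adj v x,
    swap fun v W => ∀ x ∈ W, x ≠ v → G.Adj v x]
  refine sum_le_sum fun W hW => card_attached_le_card_dominating G W ?_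
  rw [(mem_powersetCard.1 hW).2]
  omega

/-- On average over `v`, the cliques meeting the closed neighbourhood of `v` are no more
numerous than they would be if this neighbourhood were a complete component. -/
lemma sum_card_meeting_closed_nbrs_le {k : ℕ} (hk : 3 ≤ k) (U : Finset V) :
    ∑ v ∈ U, ((cliquesIn G k U).filter fun K => ¬ Disjoint K (insert v (nbrsIn G U v))).card ≤
      ∑ v ∈ U, ((nbrsIn G U v).card + 1).choose k := by
  obtain ⟨j, rfl⟩ : ∃ j, k = j + 1 := ⟨k - 1, by omega⟩
  have h1 : ∀ v ∈ U,
      ((cliquesIn G (j + 1) U).filter fun K => ¬ Disjoint K (insert v (nbrsIn G U v))).card ≤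
      (nbrsIn G U v).card.choose j +
        ((cliquesIn G (j + 1) U).filter fun K => v ∉ K ∧ ∃ x ∈ K, G.Adj v x).card := by
    intro v _
    refine le_trans (le_trans (card_le_card ?_) (card_union_le _ _))
      (Nat.add_le_add_right (card_cliquesIn_containing_le G j U v) _)
    intro K hK
    simp only [mem_filter, not_disjoint_iff, mem_insert, mem_nbrsIn] at hK
    simp only [mem_union, mem_filter]
    obtain ⟨hK, x, hx, hxv⟩ := hK
    by_cases hv : v ∈ K
    · exact Or.inl ⟨hK, hv⟩
    · rcases hxv with rfl | h
      · exact absurd hx hv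
      · exact Or.inr ⟨hK, hv, x, hx, h.2⟩
  refine (sum_le_sum h1).trans ?_
  simp only [Nat.choose_succ_succ', sum_add_distrib]
  exact Nat.add_le_add_left (sum_card_attached_le G hk U) _

lemma card_cliquesIn_le_meeting_add (k : ℕ) (U W : Finset V) :
    (cliquesIn G k U).card ≤
      ((cliquesIn G k U).filter fun K => ¬ Disjoint K W).card + (cliquesIn G k (U \ W)).card := by
  refine (card_le_card ?_).trans (card_union_le _ _)
  intro K hK
  by_cases h : Disjoint K W
  · refine mem_union_right _ ?_
    rw [mem_cliquesIn] at hK ⊢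
    exact ⟨subset_sdiff.2 ⟨hK.1, h⟩, hK.2⟩
  · exact mem_union_left _ (mem_filter.2 ⟨hK, h⟩)

lemma card_cliquesIn_meeting_le (j c : ℕ) (U W : Finset V)
    (hW : ∀ w ∈ W, (nbrsIn G U w).card ≤ c) :
    ((cliquesIn G (j + 1) U).filter fun K => ¬ Disjoint K W).card ≤ W.card * c.choose j := by
  refine le_trans (card_le_card (t := W.biUnion fun w => (cliquesIn G (j + 1) U).filter (w ∈ ·))
    ?_) (card_biUnion_le_card_mul _ _ _ fun w hw =>
      (card_cliquesIn_containing_le G j U w).trans (Nat.choose_le_choose j (hW w hw)))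
  intro K hK
  simp only [mem_filter, not_disjoint_iff] at hK
  obtain ⟨hK, w, hwK, hwW⟩ := hK
  exact mem_biUnion.2 ⟨w, hwW, mem_filter.2 ⟨hK, hwK⟩⟩

end Counting

section Containment

open scoped Classical

variable {V : Type*} {G : SimpleGraph V}

lemma exists_injective_mem {A : Finset V} {a : ℕ} (h : a ≤ A.card) :
    ∃ e : Fin a → V, Function.Injective e ∧ ∀ i, e i ∈ A :=
  ⟨fun i => A.equivFin.symm (Fin.castLE h i),
    Subtype.val_injective.comp (A.equivFin.symm.injective.comp (Fin.castLE_injective h)),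
    fun i => (A.equivFin.symm (Fin.castLE h i)).2⟩

lemma contains_doubleStar {a b : ℕ} {x y : V} (hxy : G.Adj x y) {A B : Finset V}
    (hAB : Disjoint A B) (hA : a ≤ A.card) (hB : b ≤ B.card)
    (hxA : ∀ v ∈ A, G.Adj x v ∧ v ≠ y) (hyB : ∀ v ∈ B, G.Adj y v ∧ v ≠ x) :
    Contains (doubleStar a b) G := by
  obtain ⟨e, he, heA⟩ := exists_injective_mem hA
  obtain ⟨g, hg, hgB⟩ := exists_injective_mem hB
  let f : Fin (a + b + 2) → V := fun i =>
    if h : a + 2 ≤ i.val then g ⟨i.val - 2 - a, by omega⟩ else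
      if h' : 2 ≤ i.val then e ⟨i.val - 2, by omega⟩ else if i.val = 0 then x else y
  have f0 : ∀ i : Fin (a + b + 2), i.val = 0 → f i = x := fun i h => by
    simp only [f, dif_neg (show ¬ a + 2 ≤ i.val by omega), dif_neg (show ¬ 2 ≤ i.val by omega),
      if_pos h]
  have f1 : ∀ i : Fin (a + b + 2), i.val = 1 → f i = y := fun i h => by
    simp only [f, dif_neg (show ¬ a + 2 ≤ i.val by omega), dif_neg (show ¬ 2 ≤ i.val by omega),
      if_neg (show ¬ i.val = 0 by omega)]
  have fA : ∀ (i : Fin (a + b + 2)) (_ : 2 ≤ i.val) (_ : i.val < a + 2),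
      f i = e ⟨i.val - 2, by omega⟩ := fun i h h' => by
    simp only [f, dif_neg (show ¬ a + 2 ≤ i.val by omega), dif_pos h]
  have fB : ∀ (i : Fin (a + b + 2)) (_ : a + 2 ≤ i.val),
      f i = g ⟨i.val - 2 - a, by omega⟩ := fun i h => by
    simp only [f, dif_pos h]
  have hrel : ∀ i j : Fin (a + b + 2), ((i.val = 0 ∧ j.val = 1) ∨
      (i.val = 0 ∧ 2 ≤ j.val ∧ j.val < a + 2) ∨ (i.val = 1 ∧ a + 2 ≤ j.val)) →
      G.Adj (f i) (f j) := by
    rintro i j (⟨hi, hj⟩ | ⟨hi, hj, hj'⟩ | ⟨hi, hj⟩)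
    · rw [f0 i hi, f1 j hj]; exact hxy
    · rw [f0 i hi, fA j hj hj']; exact (hxA _ (heA _)).1
    · rw [f1 i hi, fB j hj]; exact (hyB _ (hgB _)).1
  have hinj : ∀ i j : Fin (a + b + 2), i < j → f i ≠ f j := by
    intro i j hij
    rw [Fin.lt_def] at hij
    rcases (by omega : i.val = 0 ∨ i.val = 1 ∨ (2 ≤ i.val ∧ i.val < a + 2) ∨ a + 2 ≤ i.val) with
      hi | hi | ⟨hi, hi'⟩ | hi
    · rcases (by omega : j.val = 1 ∨ (2 ≤ j.val ∧ j.val < a + 2) ∨ a + 2 ≤ j.val) with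
        hj | ⟨hj, hj'⟩ | hj
      · rw [f0 i hi, f1 j hj]; exact hxy.ne
      · rw [f0 i hi, fA j hj hj']; exact (hxA _ (heA _)).1.ne
      · rw [f0 i hi, fB j hj]; exact (hyB _ (hgB _)).2.symm
    · rcases (by omega : (2 ≤ j.val ∧ j.val < a + 2) ∨ a + 2 ≤ j.val) with ⟨hj, hj'⟩ | hj
      · rw [f1 i hi, fA j hj hj']; exact (hxA _ (heA _)).2.symm
      · rw [f1 i hi, fB j hj]; exact (hyB _ (hgB _)).1.ne
    · rcases (by omega : j.val < a + 2 ∨ a + 2 ≤ j.val) with hj | hj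
      · rw [fA i hi hi', fA j (by omega) hj]
        intro h
        have := congrArg Fin.val (he h)
        simp only at this
        omega
      · rw [fA i hi hi', fB j hj]
        exact fun h => disjoint_left.1 hAB (heA _) (h ▸ hgB _)
    · rw [fB i hi, fB j (by omega)]
      intro h
      have := congrArg Fin.val (hg h)
      simp only at this
      omega
  refine ⟨⟨f, fun {i j} h => ?_⟩, fun i j h => ?_⟩
  · rw [doubleStar, SimpleGraph.fromRel_adj] at h
    rcases h.2 with h | h
    · exact hrel i j h
    · exact (hrel j i h).symm
  · rcases lt_trichotomy i j with hij | hij | hij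
    · exact absurd h (hinj i j hij)
    · exact hij
    · exact absurd h.symm (hinj j i hij)

lemma card_nbrsIn_le_of_adj {a b : ℕ} (hG : ¬ Contains (doubleStar a b) G) {U : Finset V}
    {u v : V} (huv : G.Adj u v) (hu : a + b + 1 ≤ (nbrsIn G U u).card) :
    (nbrsIn G U v).card ≤ min a b := by
  have split (c d : ℕ) (hcd : c + d = a + b) (hv : c < (nbrsIn G U v).card) :
      ∃ C D : Finset V, Disjoint C D ∧ c ≤ C.card ∧ d ≤ D.card ∧
        (∀ w ∈ C, G.Adj v w ∧ w ≠ u) ∧ ∀ w ∈ D, G.Adj u w ∧ w ≠ v := by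
    have h1 := pred_card_le_card_erase (s := nbrsIn G U v) (a := u)
    obtain ⟨C, hC, hCc⟩ := exists_subset_card_eq (show c ≤ ((nbrsIn G U v).erase u).card by omega)
    refine ⟨C, (nbrsIn G U u).erase v \ C, disjoint_sdiff, hCc.ge, ?_, fun w hw => ?_,
      fun w hw => ?_⟩
    · have h2 := pred_card_le_card_erase (s := nbrsIn G U u) (a := v)
      have h3 := le_card_sdiff C ((nbrsIn G U u).erase v)
      omega
    · have := hC hw
      rw [mem_erase, mem_nbrsIn] at this
      exact ⟨this.2.2, this.1⟩
    · rw [mem_sdiff, mem_erase, mem_nbrsIn] at hw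
      exact ⟨hw.1.2.2, hw.1.1⟩
  by_contra hcon
  rw [le_min_iff, not_and_or, not_le, not_le] at hcon
  rcases hcon with h | h
  · obtain ⟨C, D, hd, hC, hD, h1, h2⟩ := split a b rfl h
    exact hG (contains_doubleStar huv.symm hd hC hD h1 h2)
  · obtain ⟨C, D, hd, hC, hD, h1, h2⟩ := split b a (add_comm _ _) h
    exact hG (contains_doubleStar huv hd.symm hD hC h2 h1)

theorem card_cliquesIn_le_blockCount {a b k : ℕ} (hk : 3 ≤ k)
    (hG : ¬ Contains (doubleStar a b) G) (U : Finset V) :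
    (cliquesIn G k U).card ≤ blockCount (a + b + 1) k U.card := by
  induction U using Finset.strongInduction with
  | H U ih =>
    have step (W : Finset V) (hWU : W ⊆ U) (hW : W.Nonempty) (hWc : W.card ≤ a + b + 1)
        (hmeet : ((cliquesIn G k U).filter fun K => ¬ Disjoint K W).card ≤ W.card.choose k) :
        (cliquesIn G k U).card ≤ blockCount (a + b + 1) k U.card := by
      have h1 := card_cliquesIn_le_meeting_add G k U W
      have h2 := ih (U \ W) (sdiff_ssubset hWU hW)
      have h3 := choose_add_blockCount_le (k := k) (by omega) (by omega) hWc (U \ W).card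
      rw [card_sdiff_add_card_eq_card hWU] at h3
      omega
    rcases U.eq_empty_or_nonempty with rfl | hU
    · have : cliquesIn G k (∅ : Finset V) = ∅ := by
        rw [eq_empty_iff_forall_notMem]
        intro K hK
        rw [mem_cliquesIn, subset_empty] at hK
        obtain ⟨rfl, h, -⟩ := hK
        rw [card_empty] at h
        omega
      simp [this]
    by_cases hlarge : ∃ u ∈ U, a + b + 1 ≤ (nbrsIn G U u).card
    · obtain ⟨u, -, hu⟩ := hlarge
      obtain ⟨W, hW, hWc⟩ := exists_subset_card_eq hu
      obtain ⟨j, rfl⟩ : ∃ j, k = j + 1 := ⟨k - 1, by omega⟩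
      refine step W (fun w hw => ((mem_nbrsIn G).1 (hW hw)).1) (card_pos.1 (by omega)) hWc.le ?_
      refine (card_cliquesIn_meeting_le G j (min a b) U W fun w hw =>
        card_nbrsIn_le_of_adj hG ((mem_nbrsIn G).1 (hW hw)).2 hu).trans ?_
      rw [hWc]
      exact mul_choose_le_choose (by omega) j
    · push Not at hlarge
      obtain ⟨v, hv, hle⟩ := exists_le_of_sum_le hU (sum_card_meeting_closed_nbrs_le G hk U)
      have hcard : (insert v (nbrsIn G U v)).card = (nbrsIn G U v).card + 1 :=
        card_insert_of_notMem fun h => G.irrefl ((mem_nbrsIn G).1 h).2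
      refine step (insert v (nbrsIn G U v))
        (insert_subset hv fun w hw => ((mem_nbrsIn G).1 hw).1) (insert_nonempty _ _) ?_ ?_
      · have := hlarge v hv
        omega
      · rw [hcard]
        exact hle

end Containment

lemma copyCount_top_eq {V : Type*} [Fintype V] (G : SimpleGraph V) (k : ℕ) :
    _root_.copyCount (⊤ : SimpleGraph (Fin k)) G = (cliquesIn G k univ).card := by
  rw [_root_.copyCount, ← Set.ncard_coe_finset]
  symm
  refine Set.ncard_congr (fun K _ => (⊤ : G.Subgraph).induce (K : Set V)) ?_ ?_ ?_
  · intro K hK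
    rw [mem_coe, mem_cliquesIn] at hK
    obtain ⟨-, hc, hK⟩ := hK
    let e : Fin k ≃ K := (K.equivFinOfCardEq hc).symm
    refine ⟨⟨e, fun {i j} => ?_⟩⟩
    simp only [SimpleGraph.Subgraph.coe_adj, SimpleGraph.Subgraph.induce_adj,
      SimpleGraph.Subgraph.top_adj, SimpleGraph.top_adj]
    constructor
    · rintro ⟨-, -, h⟩ rfl
      exact G.irrefl h
    · intro h
      exact ⟨(e i).2, (e j).2, hK (e i).2 (e j).2 fun h' => h (e.injective (Subtype.ext h'))⟩
  · intro K L _ _ h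
    exact coe_injective (congrArg SimpleGraph.Subgraph.verts h)
  · rintro G' ⟨φ⟩
    have hadj : ∀ x ∈ G'.verts, ∀ y ∈ G'.verts, x ≠ y → G'.Adj x y := by
      intro x hx y hy hxy
      have := φ.symm.map_rel_iff (a := ⟨x, hx⟩) (b := ⟨y, hy⟩)
      rw [SimpleGraph.top_adj, SimpleGraph.Subgraph.coe_adj] at this
      exact this.1 fun h => hxy (congrArg Subtype.val (φ.symm.injective h))
    refine ⟨G'.verts.toFinite.toFinset, ?_, ?_⟩
    · rw [mem_coe, mem_cliquesIn]
      refine ⟨subset_univ _, ?_, ?_⟩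
      · rw [← Set.ncard_eq_toFinset_card, ← Nat.card_coe_set_eq, ← Nat.card_congr φ.toEquiv,
          Nat.card_fin]
      · rw [Set.Finite.coe_toFinset]
        exact fun x hx y hy hxy => (hadj x hx y hy hxy).adj_sub
    · refine SimpleGraph.Subgraph.ext (by simp) ?_
      ext x y
      simp only [SimpleGraph.Subgraph.induce_adj, SimpleGraph.Subgraph.top_adj,
        Set.Finite.coe_toFinset]
      exact ⟨fun h => hadj x h.1 y h.2.1 h.2.2.ne,
        fun h => ⟨h.fst_mem, h.snd_mem, h.adj_sub⟩⟩

/-- The disjoint union of complete graphs on consecutive blocks of `m` vertices. -/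
def blockGraph (m n : ℕ) : SimpleGraph (Fin n) where
  Adj x y := x ≠ y ∧ x.val / m = y.val / m
  symm := ⟨fun _ _ h => ⟨h.1.symm, h.2.symm⟩⟩
  loopless := ⟨fun _ h => h.1 rfl⟩

lemma not_contains_blockGraph (a b n : ℕ) :
    ¬ Contains (doubleStar a b) (blockGraph (a + b + 1) n) := by
  rintro ⟨f, hf⟩
  have hadj : ∀ x y : Fin (a + b + 2), (doubleStar a b).Adj x y →
      (f x).val / (a + b + 1) = (f y).val / (a + b + 1) := fun x y h => (f.map_rel h).2
  have h01 : (f ⟨0, by omega⟩).val / (a + b + 1) = (f ⟨1, by omega⟩).val / (a + b + 1) :=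
    hadj _ _ (by simp [doubleStar])
  have hall : ∀ x, (f x).val / (a + b + 1) = (f ⟨0, by omega⟩).val / (a + b + 1) := by
    intro x
    rcases (by omega : x.val = 0 ∨ x.val = 1 ∨ (2 ≤ x.val ∧ x.val < a + 2) ∨ a + 2 ≤ x.val) with
      h | h | h | h
    · rw [show x = ⟨0, by omega⟩ from Fin.ext h]
    · rw [show x = ⟨1, by omega⟩ from Fin.ext h, h01]
    · refine (hadj _ _ ?_).symm
      rw [doubleStar, SimpleGraph.fromRel_adj]
      refine ⟨fun h' => ?_, Or.inl (Or.inr (Or.inl ⟨rfl, h⟩))⟩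
      have := congrArg Fin.val h'
      simp only at this
      omega
    · refine Eq.trans (hadj _ _ ?_).symm h01.symm
      rw [doubleStar, SimpleGraph.fromRel_adj]
      refine ⟨fun h' => ?_, Or.inl (Or.inr (Or.inr ⟨rfl, h⟩))⟩
      have := congrArg Fin.val h'
      simp only at this
      omega
  have hinj : Function.Injective fun x : Fin (a + b + 2) =>
      (⟨(f x).val % (a + b + 1), Nat.mod_lt _ (Nat.succ_pos _)⟩ : Fin (a + b + 1)) := by
    intro x y h
    refine hf (Fin.ext ?_)
    have hmod := congrArg Fin.val h
    simp only at hmod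
    rw [← Nat.div_add_mod (f x).val (a + b + 1), ← Nat.div_add_mod (f y).val (a + b + 1),
      hall x, hall y, hmod]
  have := Fintype.card_le_of_injective _ hinj
  simp only [Fintype.card_fin] at this
  omega

lemma le_card_cliquesIn_blockGraph {m p q k : ℕ} (hq : q < m) (hk : 0 < k) :
    p * m.choose k + q.choose k ≤ (cliquesIn (blockGraph m (p * m + q)) k univ).card := by
  let block : ℕ → Finset (Fin (p * m + q)) := fun i => univ.filter fun x => x.val / m = i
  have hm : 0 < m := by omega
  have hblock (i s : ℕ) (hs : s ≤ m) (hi : i * m + s ≤ p * m + q) : s ≤ (block i).card := by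
    have h := card_le_card_of_injOn (s := (univ : Finset (Fin s))) (t := block i)
      (fun x => ⟨i * m + x.val, by omega⟩)
      (fun x _ => by
        have hx := x.isLt
        simp only [block, coe_filter, mem_univ, true_and, Set.mem_ofPred_eq]
        rw [add_comm, Nat.add_mul_div_right _ _ hm, Nat.div_eq_of_lt (by omega), zero_add])
      (fun x _ y _ h => by
        have := congrArg Fin.val h
        simp only at this
        exact Fin.ext (by omega))
    simpa using h
  have hdisj : Set.PairwiseDisjoint (range (p + 1) : Set ℕ) fun i => (block i).powersetCard k := by
    intro i _ i' _ hii'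
    refine disjoint_left.2 fun K hK hK' => hii' ?_
    rw [mem_powersetCard] at hK hK'
    obtain ⟨x, hx⟩ := card_pos.1 (hK.2 ▸ hk)
    exact (mem_filter.1 (hK.1 hx)).2.symm.trans (mem_filter.1 (hK'.1 hx)).2
  have hsub : (range (p + 1)).biUnion (fun i => (block i).powersetCard k) ⊆
      cliquesIn (blockGraph m (p * m + q)) k univ := by
    intro K hK
    simp only [mem_biUnion, mem_powersetCard] at hK
    obtain ⟨i, -, hKi, hKc⟩ := hK
    rw [mem_cliquesIn]
    exact ⟨subset_univ _, hKc, fun x hx y hy hxy =>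
      ⟨hxy, (mem_filter.1 (hKi hx)).2.trans (mem_filter.1 (hKi hy)).2.symm⟩⟩
  refine le_trans ?_ (card_le_card hsub)
  rw [card_biUnion hdisj, sum_range_succ]
  simp only [card_powersetCard]
  refine add_le_add ?_ (Nat.choose_le_choose k (hblock p q hq.le le_rfl))
  have h := card_nsmul_le_sum (range p) (fun i => (block i).card.choose k) (m.choose k)
    fun i hi => Nat.choose_le_choose k (hblock i m le_rfl (by
      have := Nat.mul_le_mul_right m (Nat.succ_le_of_lt (mem_range.1 hi))
      rw [Nat.succ_mul] at this
      omega))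
  simpa using h

end DoubleStarCliques

open DoubleStarCliques in
/-- if `n = p(a+b+1) + q` with `q ≤ a+b`, then for `k ≥ 3`,
`ex(n, K_k, S_{a,b}) = p·C(a+b+1,k) + C(q,k)`. -/
theorem exGen_cliques_doubleStar (a b p q k : ℕ) (ha : 0 < a) (hb : 0 < b)
    (hq : q ≤ a + b) (hk : 3 ≤ k) :
    exGen (p * (a + b + 1) + q) (⊤ : SimpleGraph (Fin k)) (doubleStar a b) =
      p * Nat.choose (a + b + 1) k + Nat.choose q k := by
  have hmax : blockCount (a + b + 1) k (p * (a + b + 1) + q) =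
      p * (a + b + 1).choose k + q.choose k := by
    have hlt : q < a + b + 1 := by omega
    rw [blockCount, add_comm (p * _) q, Nat.add_mul_div_right _ _ (Nat.succ_pos _),
      Nat.add_mul_mod_self_right, Nat.div_eq_of_lt hlt, Nat.mod_eq_of_lt hlt, zero_add]
  have hupper (G : SimpleGraph (Fin (p * (a + b + 1) + q))) (hG : ¬ Contains (doubleStar a b) G) :
      _root_.copyCount (⊤ : SimpleGraph (Fin k)) G ≤ p * (a + b + 1).choose k + q.choose k := by
    have := card_cliquesIn_le_blockCount hk hG Finset.univ
    rwa [Finset.card_univ, Fintype.card_fin, hmax, ← copyCount_top_eq] at this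
  refine IsGreatest.csSup_eq ⟨⟨blockGraph (a + b + 1) _, not_contains_blockGraph a b _,
    le_antisymm ?_ (hupper _ (not_contains_blockGraph a b _))⟩, ?_⟩
  · rw [copyCount_top_eq]
    exact le_card_cliquesIn_blockGraph (by omega) (by omega)
  · rintro N ⟨G, hG, rfl⟩
    exact hupper G hG
end

section
/- Let c ≤ a ≤ b < d be positive integers and suppose r is nice (i.e., r = d·C(d−1,a)·C(d−1,b) when a ≠ b, respectively r = (d/2)·C(d−1,a)·C(d−1,b) when a = b). Then there exists n₀ such that for every n ≥ n₀ with dn even, ex(n, S_{a,b}, S_{c,d}) = r·n. -/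
open SimpleGraph

section DoubleStar

variable {V : Type*}

/-- The vertices `u`, `v` together with the leaf sets `A`, `B` span a double star `S_{a,b}`
in `G`, with `a` leaves `A` attached to `u` and `b` leaves `B` attached to `v`. -/
structure IsDoubleStar (G : SimpleGraph V) (a b : ℕ) (u v : V) (A B : Finset V) : Prop where
  adj : G.Adj u v
  adj_left : ∀ x ∈ A, G.Adj u x
  adj_right : ∀ x ∈ B, G.Adj v x
  notMem_left : v ∉ A
  notMem_right : u ∉ B
  card_left : A.card = a
  card_right : B.card = b
  disjoint : Disjoint A B

/-- The edges of the double star with centres `u`, `v` and leaf sets `A`, `B`,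
oriented away from `u`. -/
def StarRel (u v : V) (A B : Finset V) (x y : V) : Prop :=
  (x = u ∧ y = v) ∨ (x = u ∧ y ∈ A) ∨ (x = v ∧ y ∈ B)

/-- The double star with centres `u`, `v` and leaf sets `A`, `B` as a subgraph of `G`. -/
def starSubgraph (G : SimpleGraph V) (u v : V) (A B : Finset V) : G.Subgraph where
  verts := {x | x = u ∨ x = v ∨ x ∈ A ∨ x ∈ B}
  Adj x y := G.Adj x y ∧ (StarRel u v A B x y ∨ StarRel u v A B y x)
  adj_sub h := h.1
  edge_vert h := by
    simp only [StarRel, Set.mem_ofPred_eq] at h ⊢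
    tauto
  symm := ⟨fun _ _ h => ⟨h.1.symm, h.2.symm⟩⟩

lemma starSubgraph_swap (G : SimpleGraph V) (u v : V) (A B : Finset V) :
    starSubgraph G v u B A = starSubgraph G u v A B := by
  ext x y
  · simp only [starSubgraph, Set.mem_ofPred_eq]
    tauto
  · simp only [starSubgraph, StarRel]
    tauto

namespace IsDoubleStar

variable {G : SimpleGraph V} {a b : ℕ} {u v : V} {A B : Finset V}

lemma swap (h : IsDoubleStar G a b u v A B) : IsDoubleStar G b a v u B A :=
  ⟨h.adj.symm, h.adj_right, h.adj_left, h.notMem_right, h.notMem_left, h.card_right,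
    h.card_left, h.disjoint.symm⟩

lemma adj_left_iff (h : IsDoubleStar G a b u v A B) (y : V) :
    (starSubgraph G u v A B).Adj u y ↔ y = v ∨ y ∈ A := by
  have h1 := h.adj.ne
  have h2 : u ∉ A := fun hu => (h.adj_left u hu).ne rfl
  have h3 := h.notMem_right
  have h4 := h.adj
  have h5 := h.adj_left y
  simp only [starSubgraph, StarRel]
  constructor
  · rintro ⟨-, h | h⟩ <;> grind
  · rintro (rfl | hy)
    · exact ⟨h4, by simp⟩
    · exact ⟨h5 hy, by simp [hy]⟩

/-- A vertex with two distinct neighbours in a double star is one of its centres. -/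
lemma eq_or_eq_of_adj (h : IsDoubleStar G a b u v A B) {x y z : V} (hyz : y ≠ z)
    (hy : (starSubgraph G u v A B).Adj x y) (hz : (starSubgraph G u v A B).Adj x z) :
    x = u ∨ x = v := by
  have h1 : x ∈ A → x ∉ B := fun hx => Finset.disjoint_left.1 h.disjoint hx
  have h2 := hy.2
  have h3 := hz.2
  simp only [StarRel] at h2 h3
  grind

lemma left_eq_or_eq (h : IsDoubleStar G a b u v A B) (ha : 0 < a) {a' b' : ℕ} {u' v' : V}
    {A' B' : Finset V} (h' : IsDoubleStar G a' b' u' v' A' B')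
    (e : starSubgraph G u v A B = starSubgraph G u' v' A' B') : u = u' ∨ u = v' := by
  obtain ⟨x, hx⟩ := Finset.card_pos.1 (h.card_left ▸ ha)
  refine h'.eq_or_eq_of_adj (x := u) (y := v) (z := x) ?_ ?_ ?_
  · rintro rfl
    exact h.notMem_left hx
  · rw [← e, h.adj_left_iff]
    exact Or.inl rfl
  · rw [← e, h.adj_left_iff]
    exact Or.inr hx

lemma leaves_eq (h : IsDoubleStar G a b u v A B) {a' b' : ℕ} {A' B' : Finset V}
    (h' : IsDoubleStar G a' b' u v A' B')
    (e : starSubgraph G u v A B = starSubgraph G u v A' B') : A = A' := by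
  ext x
  have h1 := h.adj_left_iff x
  rw [e, h'.adj_left_iff] at h1
  have h2 := h.notMem_left
  have h3 := h'.notMem_left
  grind

/-- A double star subgraph determines its centres and leaf sets up to swapping. -/
lemma eq_or_eq_swap (h : IsDoubleStar G a b u v A B) (ha : 0 < a) (hb : 0 < b)
    {a' b' : ℕ} {u' v' : V} {A' B' : Finset V} (h' : IsDoubleStar G a' b' u' v' A' B')
    (e : starSubgraph G u v A B = starSubgraph G u' v' A' B') :
    (u = u' ∧ v = v' ∧ A = A' ∧ B = B') ∨ (u = v' ∧ v = u' ∧ A = B' ∧ B = A') := by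
  have hu := h.left_eq_or_eq ha h' e
  have hv := h.swap.left_eq_or_eq hb h' (by rwa [starSubgraph_swap])
  have h1 := h.adj.ne
  have key : (u = u' ∧ v = v') ∨ (u = v' ∧ v = u') := by grind
  obtain ⟨rfl, rfl⟩ | ⟨rfl, rfl⟩ := key
  · refine Or.inl ⟨rfl, rfl, h.leaves_eq h' e, h.swap.leaves_eq h'.swap ?_⟩
    rwa [starSubgraph_swap G u v A B, starSubgraph_swap G u v A' B']
  · rw [← starSubgraph_swap G v u A' B'] at e
    refine Or.inr ⟨rfl, rfl, h.leaves_eq h'.swap e, h.swap.leaves_eq h' ?_⟩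
    rwa [starSubgraph_swap, ← starSubgraph_swap G v u A' B']

end IsDoubleStar

lemma doubleStar_adj_iff {a b : ℕ} (i j : Fin (a + b + 2)) :
    (doubleStar a b).Adj i j ↔
      ((i.val = 0 ∧ j.val = 1) ∨ (i.val = 0 ∧ 2 ≤ j.val ∧ j.val < a + 2) ∨
        (i.val = 1 ∧ a + 2 ≤ j.val)) ∨
      ((j.val = 0 ∧ i.val = 1) ∨ (j.val = 0 ∧ 2 ≤ i.val ∧ i.val < a + 2) ∨
        (j.val = 1 ∧ a + 2 ≤ i.val)) := by
  simp only [doubleStar, SimpleGraph.fromRel_adj, ne_eq, Fin.ext_iff]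
  omega

lemma toSubgraph_eq_starSubgraph {G : SimpleGraph V} {a b : ℕ} {u v : V} {A B : Finset V}
    (f : Copy (doubleStar a b) G) (hu : ∀ i, f i = u ↔ i.val = 0) (hv : ∀ i, f i = v ↔ i.val = 1)
    (hA : ∀ i, f i ∈ A ↔ 2 ≤ i.val ∧ i.val < a + 2) (hB : ∀ i, f i ∈ B ↔ a + 2 ≤ i.val)
    (hr : ∀ x, (x = u ∨ x = v ∨ x ∈ A ∨ x ∈ B) → ∃ i, f i = x) :
    f.toSubgraph = starSubgraph G u v A B := by
  ext x y
  · simp only [Copy.toSubgraph, starSubgraph, Subgraph.map_verts, Subgraph.verts_top,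
      Set.image_univ, Set.mem_range, Set.mem_ofPred_eq]
    refine ⟨?_, hr x⟩
    rintro ⟨i, rfl⟩
    have h1 := hu i
    have h2 := hv i
    have h3 := hA i
    have h4 := hB i
    simp only [Copy.toHom_apply, h1, h2, h3, h4]
    omega
  · simp only [Copy.toSubgraph, starSubgraph, Subgraph.map_adj, Relation.Map, Subgraph.top_adj]
    constructor
    · rintro ⟨i, j, hij, rfl, rfl⟩
      refine ⟨f.toHom.map_adj hij, ?_⟩
      simpa only [StarRel, Copy.toHom_apply, hu, hv, hA, hB] using (doubleStar_adj_iff i j).1 hij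
    · rintro ⟨-, h⟩
      have hx : ∃ i, f i = x := hr x (by simp only [StarRel] at h; tauto)
      have hy : ∃ i, f i = y := hr y (by simp only [StarRel] at h; tauto)
      obtain ⟨i, rfl⟩ := hx
      obtain ⟨j, rfl⟩ := hy
      refine ⟨i, j, (doubleStar_adj_iff i j).2 ?_, rfl, rfl⟩
      simpa only [StarRel, hu, hv, hA, hB] using h

/-- Every copy of `S_{a,b}` comes from two centres and two leaf sets. -/
lemma exists_isDoubleStar_of_copy {G : SimpleGraph V} {a b : ℕ} (f : Copy (doubleStar a b) G) :
    ∃ u v A B, IsDoubleStar G a b u v A B ∧ f.toSubgraph = starSubgraph G u v A B := by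
  classical
  have hinj : Function.Injective f := f.injective
  have hf : ∀ i j, f i = f j ↔ i = j := fun i j => hinj.eq_iff
  have hadj : ∀ i j, (doubleStar a b).Adj i j → G.Adj (f i) (f j) :=
    fun i j h => f.toHom.map_adj h
  have h0 : ((0 : Fin (a + b + 2)) : ℕ) = 0 := rfl
  have h1 : ((1 : Fin (a + b + 2)) : ℕ) = 1 := by simp
  refine ⟨f 0, f 1, (Finset.univ.filter fun i => 2 ≤ i.val ∧ i.val < a + 2).image f,
    (Finset.univ.filter fun i => a + 2 ≤ i.val).image f, ⟨?_, ?_, ?_, ?_, ?_, ?_, ?_, ?_⟩,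
    toSubgraph_eq_starSubgraph f ?_ ?_ ?_ ?_ ?_⟩
  · exact hadj _ _ (by rw [doubleStar_adj_iff]; omega)
  · simp only [Finset.mem_image, Finset.mem_filter, Finset.mem_univ, true_and]
    rintro _ ⟨i, hi, rfl⟩
    exact hadj _ _ (by rw [doubleStar_adj_iff]; omega)
  · simp only [Finset.mem_image, Finset.mem_filter, Finset.mem_univ, true_and]
    rintro _ ⟨i, hi, rfl⟩
    exact hadj _ _ (by rw [doubleStar_adj_iff]; omega)
  · simp only [Finset.mem_image, Finset.mem_filter, Finset.mem_univ, true_and, hf, Fin.ext_iff]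
    rintro ⟨i, hi, h⟩
    omega
  · simp only [Finset.mem_image, Finset.mem_filter, Finset.mem_univ, true_and, hf, Fin.ext_iff]
    rintro ⟨i, hi, h⟩
    omega
  · rw [Finset.card_image_of_injective _ hinj, ← Finset.card_map Fin.valEmbedding]
    trans (Finset.Ico 2 (a + 2)).card
    · congr 1
      ext x
      simp only [Finset.mem_map, Finset.mem_filter, Finset.mem_univ, true_and,
        Fin.valEmbedding_apply, Finset.mem_Ico]
      exact ⟨fun ⟨i, hi, h⟩ => h ▸ hi, fun h => ⟨⟨x, by omega⟩, h, rfl⟩⟩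
    · simp
  · rw [Finset.card_image_of_injective _ hinj, ← Finset.card_map Fin.valEmbedding]
    trans (Finset.Ico (a + 2) (a + b + 2)).card
    · congr 1
      ext x
      simp only [Finset.mem_map, Finset.mem_filter, Finset.mem_univ, true_and,
        Fin.valEmbedding_apply, Finset.mem_Ico]
      exact ⟨fun ⟨i, hi, h⟩ => by omega, fun h => ⟨⟨x, by omega⟩, h.1, rfl⟩⟩
    · rw [Nat.card_Ico]
      omega
  · rw [Finset.disjoint_image hinj, Finset.disjoint_left]
    simp only [Finset.mem_filter, Finset.mem_univ, true_and]
    intro i hi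
    omega
  · intro i
    rw [hf, Fin.ext_iff, h0]
  · intro i
    rw [hf, Fin.ext_iff, h1]
  · intro i
    simp [hf]
  · intro i
    simp [hf]
  · intro x
    simp only [Finset.mem_image, Finset.mem_filter, Finset.mem_univ, true_and]
    rintro (rfl | rfl | ⟨i, -, rfl⟩ | ⟨i, -, rfl⟩) <;> exact ⟨_, rfl⟩

lemma IsDoubleStar.exists_copy {G : SimpleGraph V} {a b : ℕ} {u v : V} {A B : Finset V}
    (h : IsDoubleStar G a b u v A B) :
    ∃ f : Copy (doubleStar a b) G, f.toSubgraph = starSubgraph G u v A B := by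
  classical
  let eA := A.equivFinOfCardEq h.card_left
  let eB := B.equivFinOfCardEq h.card_right
  let f : Fin (a + b + 2) → V := fun i =>
    if i.val = 0 then u else if i.val = 1 then v else
      if hi : 2 ≤ i.val ∧ i.val < a + 2 then eA.symm ⟨i.val - 2, by omega⟩
      else if hi : a + 2 ≤ i.val then eB.symm ⟨i.val - (a + 2), by omega⟩ else u
  have f0 : ∀ i, i.val = 0 → f i = u := fun i hi => by simp [f, hi]
  have f1 : ∀ i, i.val = 1 → f i = v := fun i hi => by
    have h0 : i.val ≠ 0 := by omega
    simp only [f, if_neg h0, if_pos hi]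
  have fA : ∀ i (hi : 2 ≤ i.val ∧ i.val < a + 2), f i = eA.symm ⟨i.val - 2, by omega⟩ :=
    fun i hi => by
      have h0 : i.val ≠ 0 := by omega
      have h1 : i.val ≠ 1 := by omega
      simp only [f, if_neg h0, if_neg h1, dif_pos hi]
  have fB : ∀ i (hi : a + 2 ≤ i.val), f i = eB.symm ⟨i.val - (a + 2), by omega⟩ :=
    fun i hi => by
      have h0 : i.val ≠ 0 := by omega
      have h1 : i.val ≠ 1 := by omega
      have h2 : ¬ (2 ≤ i.val ∧ i.val < a + 2) := by omega
      simp only [f, if_neg h0, if_neg h1, dif_neg h2, dif_pos hi]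
  have mA : ∀ i : Fin (a + b + 2), 2 ≤ i.val ∧ i.val < a + 2 → f i ∈ A :=
    fun i hi => by rw [fA i hi]; exact Finset.coe_mem _
  have mB : ∀ i : Fin (a + b + 2), a + 2 ≤ i.val → f i ∈ B :=
    fun i hi => by rw [fB i hi]; exact Finset.coe_mem _
  have huv := h.adj.ne
  have huA : u ∉ A := fun hu => (h.adj_left u hu).ne rfl
  have hvB : v ∉ B := fun hv => (h.adj_right v hv).ne rfl
  have huB := h.notMem_right
  have hvA := h.notMem_left
  have hAB : ∀ x, x ∈ A → x ∉ B := fun x hx => Finset.disjoint_left.1 h.disjoint hx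
  have cases : ∀ i : Fin (a + b + 2),
      i.val = 0 ∨ i.val = 1 ∨ (2 ≤ i.val ∧ i.val < a + 2) ∨ a + 2 ≤ i.val := fun i => by omega
  have hu : ∀ i, f i = u ↔ i.val = 0 := fun i => by
    refine ⟨fun e => ?_, f0 i⟩
    have h1 := f1 i
    have h2 := mA i
    have h3 := mB i
    rcases cases i with hi | hi | hi | hi <;> grind
  have hv : ∀ i, f i = v ↔ i.val = 1 := fun i => by
    refine ⟨fun e => ?_, f1 i⟩
    have h1 := f0 i
    have h2 := mA i
    have h3 := mB i
    rcases cases i with hi | hi | hi | hi <;> grind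
  have hA : ∀ i, f i ∈ A ↔ 2 ≤ i.val ∧ i.val < a + 2 := fun i => by
    refine ⟨fun e => ?_, mA i⟩
    have h0 := f0 i
    have h1 := f1 i
    have h3 := mB i
    rcases cases i with hi | hi | hi | hi <;> grind
  have hB : ∀ i, f i ∈ B ↔ a + 2 ≤ i.val := fun i => by
    refine ⟨fun e => ?_, mB i⟩
    have h0 := f0 i
    have h1 := f1 i
    have h3 := mA i
    rcases cases i with hi | hi | hi | hi <;> grind
  have hr : ∀ x, (x = u ∨ x = v ∨ x ∈ A ∨ x ∈ B) → ∃ i, f i = x := by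
    rintro x (rfl | rfl | hx | hx)
    · exact ⟨⟨0, by omega⟩, f0 _ rfl⟩
    · exact ⟨⟨1, by omega⟩, f1 _ rfl⟩
    · have hlt := (eA ⟨x, hx⟩).isLt
      refine ⟨⟨eA ⟨x, hx⟩ + 2, by omega⟩, ?_⟩
      rw [fA _ ⟨by simp, by simp⟩]
      simp
    · have hlt := (eB ⟨x, hx⟩).isLt
      refine ⟨⟨eB ⟨x, hx⟩ + (a + 2), by omega⟩, ?_⟩
      rw [fB _ (by simp)]
      simp
  have hinj : Function.Injective f := by
    intro i j hij
    have u1 := hu i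
    have v1 := hv i
    have A1 := hA i
    have B1 := hB i
    rw [hij] at u1 v1 A1 B1
    rw [hu] at u1
    rw [hv] at v1
    rw [hA] at A1
    rw [hB] at B1
    rw [Fin.ext_iff]
    rcases cases i with hi | hi | hi | hi
    · omega
    · omega
    · rw [fA i hi, fA j (by omega)] at hij
      have := Fin.ext_iff.1 (eA.symm.injective (Subtype.ext hij))
      simp only at this
      omega
    · rw [fB i hi, fB j (by omega)] at hij
      have := Fin.ext_iff.1 (eB.symm.injective (Subtype.ext hij))
      simp only at this
      omega
  have key : ∀ i j : Fin (a + b + 2), ((i.val = 0 ∧ j.val = 1) ∨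
      (i.val = 0 ∧ 2 ≤ j.val ∧ j.val < a + 2) ∨ (i.val = 1 ∧ a + 2 ≤ j.val)) →
      G.Adj (f i) (f j) := by
    rintro i j (⟨hi, hj⟩ | ⟨hi, hj⟩ | ⟨hi, hj⟩)
    · rw [f0 i hi, f1 j hj]
      exact h.adj
    · rw [f0 i hi]
      exact h.adj_left _ (mA j hj)
    · rw [f1 i hi]
      exact h.adj_right _ (mB j hj)
  have hhom : ∀ {i j}, (doubleStar a b).Adj i j → G.Adj (f i) (f j) := by
    intro i j hij
    rcases (doubleStar_adj_iff i j).1 hij with hij | hij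
    · exact key i j hij
    · exact (key j i hij).symm
  exact ⟨⟨⟨f, hhom⟩, hinj⟩, toSubgraph_eq_starSubgraph _ hu hv hA hB hr⟩

lemma contains_doubleStar_iff {G : SimpleGraph V} {a b : ℕ} :
    Contains (doubleStar a b) G ↔ ∃ u v A B, IsDoubleStar G a b u v A B := by
  constructor
  · rintro ⟨f, hf⟩
    obtain ⟨u, v, A, B, h, -⟩ := exists_isDoubleStar_of_copy ⟨f, hf⟩
    exact ⟨u, v, A, B, h⟩
  · rintro ⟨u, v, A, B, h⟩
    obtain ⟨f, -⟩ := h.exists_copy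
    exact ⟨f.toHom, f.injective⟩

end DoubleStar

/-- Disjoint subsets of prescribed sizes exist under Hall's condition. -/
lemma exists_disjoint_subsets_card_eq {V : Type*} [DecidableEq V] {P Q : Finset V} {c d : ℕ}
    (hP : c ≤ P.card) (hQ : d ≤ Q.card) (hPQ : c + d ≤ (P ∪ Q).card) :
    ∃ C D, C ⊆ P ∧ D ⊆ Q ∧ C.card = c ∧ D.card = d ∧ Disjoint C D := by
  rcases le_total c (P \ Q).card with h | h
  · obtain ⟨C, hC, hCc⟩ := Finset.exists_subset_card_eq h
    obtain ⟨D, hD, hDd⟩ := Finset.exists_subset_card_eq hQ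
    exact ⟨C, D, hC.trans Finset.sdiff_subset, hD, hCc, hDd,
      Finset.disjoint_of_subset_left hC (Finset.disjoint_of_subset_right hD Finset.sdiff_disjoint)⟩
  · obtain ⟨C, hPC, hCP, hCc⟩ := Finset.exists_subsuperset_card_eq Finset.sdiff_subset h hP
    have hd : d ≤ (Q \ C).card := by
      have hsub : P ∪ Q ⊆ C ∪ Q \ C := by
        intro x hx
        have := @hPC x
        simp only [Finset.mem_union, Finset.mem_sdiff] at hx this ⊢
        tauto
      have h1 := Finset.card_le_card hsub
      have h2 := Finset.card_union_le C (Q \ C)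
      omega
    obtain ⟨D, hD, hDd⟩ := Finset.exists_subset_card_eq hd
    exact ⟨C, D, hCP, hD.trans Finset.sdiff_subset, hCc, hDd,
      Finset.disjoint_of_subset_right hD Finset.disjoint_sdiff⟩

section Counting

variable {V : Type*} [Fintype V] [DecidableEq V] (G : SimpleGraph V) [DecidableRel G.Adj]

/-- The pairs of disjoint leaf sets, of sizes `a` and `b`, that complete the edge `uv` to a
double star `S_{a,b}` in `G`. -/
def leafPairs (a b : ℕ) (u v : V) : Finset (Finset V × Finset V) :=
  (((G.neighborFinset u).erase v).powersetCard a ×ˢ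
    ((G.neighborFinset v).erase u).powersetCard b).filter fun q => Disjoint q.1 q.2

/-- All tuples of two centres and two leaf sets spanning a double star `S_{a,b}` in `G`. -/
def doubleStarTuples (a b : ℕ) : Finset (Σ _ : V × V, Finset V × Finset V) :=
  (Finset.univ.filter fun p : V × V => G.Adj p.1 p.2).sigma fun p => leafPairs G a b p.1 p.2

variable {G}

lemma mem_doubleStarTuples {a b : ℕ} {u v : V} {A B : Finset V} :
    (⟨(u, v), (A, B)⟩ : Σ _ : V × V, Finset V × Finset V) ∈ doubleStarTuples G a b ↔
      IsDoubleStar G a b u v A B := by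
  simp only [doubleStarTuples, leafPairs, Finset.mem_sigma, Finset.mem_filter, Finset.mem_univ,
    true_and, Finset.mem_product, Finset.mem_powersetCard, Finset.subset_iff, Finset.mem_erase,
    mem_neighborFinset]
  constructor
  · rintro ⟨h1, ⟨⟨h2, h3⟩, h4, h5⟩, h6⟩
    exact ⟨h1, fun x hx => (h2 hx).2, fun x hx => (h4 hx).2, fun hx => (h2 hx).1 rfl,
      fun hx => (h4 hx).1 rfl, h3, h5, h6⟩
  · rintro ⟨h1, h2, h3, h4, h5, h6, h7, h8⟩
    exact ⟨h1, ⟨⟨fun x hx => ⟨fun e => h4 (e ▸ hx), h2 x hx⟩, h6⟩,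
      fun x hx => ⟨fun e => h5 (e ▸ hx), h3 x hx⟩, h7⟩, h8⟩

lemma card_doubleStarTuples (a b : ℕ) :
    (doubleStarTuples G a b).card =
      ∑ u, ∑ v ∈ G.neighborFinset u, (leafPairs G a b u v).card := by
  rw [doubleStarTuples, Finset.card_sigma, Finset.sum_filter, Fintype.sum_prod_type]
  refine Finset.sum_congr rfl fun u _ => ?_
  rw [← Finset.sum_filter]
  refine Finset.sum_congr ?_ fun _ _ => rfl
  ext v
  simp

/-- Every copy of `S_{a,b}` is counted by exactly one tuple if `a ≠ b`, and by exactly two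
if `a = b`. -/
lemma card_doubleStarTuples_eq_mul_copyCount {a b : ℕ} (ha : 0 < a) (hb : 0 < b) :
    (doubleStarTuples G a b).card =
      (if a = b then 2 else 1) * _root_.copyCount (doubleStar a b) G := by
  classical
  let star : (Σ _ : V × V, Finset V × Finset V) → G.Subgraph :=
    fun t => starSubgraph G t.1.1 t.1.2 t.2.1 t.2.2
  have himage : {G' : G.Subgraph | Nonempty (doubleStar a b ≃g G'.coe)} =
      ((doubleStarTuples G a b).image star : Set G.Subgraph) := by
    rw [← Copy.range_toSubgraph]
    ext K
    simp only [Set.mem_range, Finset.coe_image, Set.mem_image, Finset.mem_coe]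
    constructor
    · rintro ⟨f, rfl⟩
      obtain ⟨u, v, A, B, h, e⟩ := exists_isDoubleStar_of_copy f
      exact ⟨⟨(u, v), (A, B)⟩, mem_doubleStarTuples.2 h, e.symm⟩
    · rintro ⟨⟨⟨u, v⟩, A, B⟩, ht, rfl⟩
      exact (mem_doubleStarTuples.1 ht).exists_copy
  rw [_root_.copyCount, himage, Set.ncard_coe_finset, Finset.card_eq_sum_card_image star,
    mul_comm, ← smul_eq_mul]
  refine Finset.sum_const_nat ?_
  intro K hK
  obtain ⟨⟨⟨u, v⟩, A, B⟩, ht, rfl⟩ := Finset.mem_image.1 hK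
  have h := mem_doubleStarTuples.1 ht
  split_ifs with hab
  · subst hab
    rw [Finset.card_eq_two]
    refine ⟨⟨(u, v), (A, B)⟩, ⟨(v, u), (B, A)⟩, ?_, ?_⟩
    · intro e
      simp only [Sigma.mk.injEq, Prod.mk.injEq] at e
      exact h.adj.ne e.1.1
    · ext ⟨⟨u', v'⟩, A', B'⟩
      simp only [Finset.mem_filter, Finset.mem_insert, Finset.mem_singleton, mem_doubleStarTuples,
        Sigma.mk.injEq, Prod.mk.injEq, heq_eq_eq, star]
      constructor
      · rintro ⟨h', e⟩
        have := h'.eq_or_eq_swap ha ha h e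
        tauto
      · rintro (⟨⟨rfl, rfl⟩, rfl, rfl⟩ | ⟨⟨rfl, rfl⟩, rfl, rfl⟩)
        · exact ⟨h, rfl⟩
        · exact ⟨h.swap, starSubgraph_swap ..⟩
  · rw [Finset.card_eq_one]
    refine ⟨⟨(u, v), (A, B)⟩, ?_⟩
    ext ⟨⟨u', v'⟩, A', B'⟩
    simp only [Finset.mem_filter, Finset.mem_singleton, mem_doubleStarTuples,
      Sigma.mk.injEq, Prod.mk.injEq, heq_eq_eq, star]
    constructor
    · rintro ⟨h', e⟩
      obtain e | ⟨-, -, rfl, -⟩ := h'.eq_or_eq_swap ha hb h e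
      · tauto
      · exact absurd (h'.card_left.symm.trans h.card_right) hab
    · rintro ⟨⟨rfl, rfl⟩, rfl, rfl⟩
      exact ⟨h, rfl⟩

lemma card_leafPairs_le_mul (a b : ℕ) {u v : V} (huv : G.Adj u v) :
    (leafPairs G a b u v).card ≤ (G.degree u - 1).choose a * (G.degree v - 1).choose b := by
  refine (Finset.card_filter_le _ _).trans_eq ?_
  rw [Finset.card_product, Finset.card_powersetCard, Finset.card_powersetCard,
    Finset.card_erase_of_mem (by simpa using huv),
    Finset.card_erase_of_mem (by simpa using huv.symm), card_neighborFinset_eq_degree,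
    card_neighborFinset_eq_degree]

lemma card_leafPairs_le_of_card_union_le {a b m : ℕ} {u v : V}
    (hm : ((G.neighborFinset u).erase v ∪ (G.neighborFinset v).erase u).card ≤ m) :
    (leafPairs G a b u v).card ≤ m.choose a * (m - a).choose b := by
  set S := (G.neighborFinset u).erase v ∪ (G.neighborFinset v).erase u
  have hsub : leafPairs G a b u v ⊆ ((S.powersetCard a).sigma fun A =>
      (S \ A).powersetCard b).map (Equiv.sigmaEquivProd _ _).toEmbedding := by
    rintro ⟨A, B⟩ h
    simp only [leafPairs, Finset.mem_filter, Finset.mem_product, Finset.mem_powersetCard] at h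
    obtain ⟨⟨⟨h1, h2⟩, h3, h4⟩, h5⟩ := h
    simp only [Finset.mem_map, Finset.mem_sigma, Finset.mem_powersetCard]
    exact ⟨⟨A, B⟩, ⟨⟨h1.trans Finset.subset_union_left, h2⟩,
      Finset.subset_sdiff.2 ⟨h3.trans Finset.subset_union_right, h5.symm⟩, h4⟩, rfl⟩
  refine (Finset.card_le_card hsub).trans ?_
  rw [Finset.card_map, Finset.card_sigma]
  have hterm : ∀ A ∈ S.powersetCard a, ((S \ A).powersetCard b).card = (S.card - a).choose b := by
    intro A hA
    rw [Finset.mem_powersetCard] at hA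
    rw [Finset.card_powersetCard, Finset.card_sdiff_of_subset hA.1, hA.2]
  rw [Finset.sum_congr rfl hterm, Finset.sum_const, Finset.card_powersetCard, smul_eq_mul]
  exact Nat.mul_le_mul (Nat.choose_le_choose _ hm) (Nat.choose_le_choose _ (by omega))

lemma contains_doubleStar_of_card {c d : ℕ} {u v : V} (huv : G.Adj u v) (hu : c < G.degree u)
    (hv : d < G.degree v)
    (hS : c + d ≤ ((G.neighborFinset u).erase v ∪ (G.neighborFinset v).erase u).card) :
    Contains (doubleStar c d) G := by
  have hP : c ≤ ((G.neighborFinset u).erase v).card := by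
    rw [Finset.card_erase_of_mem (by simpa using huv), card_neighborFinset_eq_degree]
    omega
  have hQ : d ≤ ((G.neighborFinset v).erase u).card := by
    rw [Finset.card_erase_of_mem (by simpa using huv.symm), card_neighborFinset_eq_degree]
    omega
  obtain ⟨C, D, hC, hD, hCc, hDd, hCD⟩ := exists_disjoint_subsets_card_eq hP hQ hS
  refine contains_doubleStar_iff.2 ⟨u, v, C, D, mem_doubleStarTuples.1 ?_⟩
  simp only [doubleStarTuples, leafPairs, Finset.mem_sigma, Finset.mem_filter, Finset.mem_univ,
    true_and, Finset.mem_product, Finset.mem_powersetCard]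
  exact ⟨huv, ⟨⟨hC, hCc⟩, hD, hDd⟩, hCD⟩

lemma leafPairs_eq_empty {a b : ℕ} {u v : V} (huv : G.Adj u v)
    (h : G.degree u ≤ a ∨ G.degree v ≤ b) : leafPairs G a b u v = ∅ := by
  have hu := G.degree_pos_iff_exists_adj u |>.2 ⟨v, huv⟩
  have hv := G.degree_pos_iff_exists_adj v |>.2 ⟨u, huv.symm⟩
  rw [← Finset.card_eq_zero, ← Nat.le_zero]
  refine (card_leafPairs_le_mul a b huv).trans_eq ?_
  rw [mul_eq_zero, Nat.choose_eq_zero_iff, Nat.choose_eq_zero_iff]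
  omega

/-- In an `S_{c,d}`-free graph, an edge with an endpoint of degree greater than `d` that is
central in some `S_{a,b}` has few vertices adjacent to its endpoints. -/
lemma card_union_lt_of_not_contains {a b c d : ℕ} (hca : c ≤ a) (hab : a ≤ b)
    (hG : ¬ Contains (doubleStar c d) G) {u v : V} (huv : G.Adj u v)
    (hdeg : d < G.degree u ∨ d < G.degree v) (hne : leafPairs G a b u v ≠ ∅) :
    ((G.neighborFinset u).erase v ∪ (G.neighborFinset v).erase u).card < c + d := by
  by_contra! hS
  have hu : a < G.degree u := by
    by_contra! h
    exact hne (leafPairs_eq_empty huv (Or.inl h))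
  have hv : b < G.degree v := by
    by_contra! h
    exact hne (leafPairs_eq_empty huv (Or.inr h))
  rcases hdeg with h | h
  · exact hG (contains_doubleStar_of_card huv.symm (by omega) h (by rwa [Finset.union_comm]))
  · exact hG (contains_doubleStar_of_card huv (by omega) h hS)

lemma sum_card_leafPairs_le {a b c d : ℕ} (hca : c ≤ a) (hab : a ≤ b)
    (hG : ¬ Contains (doubleStar c d) G) (u : V) :
    ∑ v ∈ G.neighborFinset u, (leafPairs G a b u v).card ≤
      max ((c + d) * ((c + d - 1).choose a * (c + d - 1 - a).choose b))
        (d * ((d - 1).choose a * (d - 1).choose b)) := by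
  set X := (d - 1).choose a * (d - 1).choose b
  set Y := (c + d - 1).choose a * (c + d - 1 - a).choose b
  have hY' : ∀ v, G.Adj u v → (d < G.degree u ∨ d < G.degree v) →
      (leafPairs G a b u v).card ≤ Y := by
    intro v huv hdeg
    by_cases hne : leafPairs G a b u v = ∅
    · simp [hne]
    · exact card_leafPairs_le_of_card_union_le
        (Nat.le_sub_one_of_lt (card_union_lt_of_not_contains hca hab hG huv hdeg hne))
  rcases le_or_gt (G.degree u) d with hu | hu
  · have hXY : ∀ v ∈ G.neighborFinset u, (leafPairs G a b u v).card ≤ max Y X := by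
      intro v hv
      rw [mem_neighborFinset] at hv
      rcases le_or_gt (G.degree v) d with hd | hd
      · refine le_max_of_le_right ((card_leafPairs_le_mul a b hv).trans ?_)
        exact Nat.mul_le_mul (Nat.choose_le_choose _ (by omega)) (Nat.choose_le_choose _ (by omega))
      · exact le_max_of_le_left (hY' v hv (Or.inr hd))
    refine (Finset.sum_le_card_nsmul _ _ _ hXY).trans ?_
    rw [card_neighborFinset_eq_degree, smul_eq_mul]
    refine (Nat.mul_le_mul_right _ hu).trans ?_
    rw [mul_max]
    exact max_le_max (Nat.mul_le_mul_right _ (by omega)) le_rfl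
  · refine le_max_of_le_left ?_
    by_cases hall : ∀ v ∈ G.neighborFinset u, leafPairs G a b u v = ∅
    · rw [Finset.sum_eq_zero fun v hv => by simp [hall v hv]]
      exact Nat.zero_le _
    · push Not at hall
      obtain ⟨v, hv, hne⟩ := hall
      rw [mem_neighborFinset] at hv
      have h1 := card_union_lt_of_not_contains hca hab hG hv (Or.inl hu) hne.ne_empty
      have h2 := Finset.card_le_card (Finset.subset_union_left
        (s₁ := (G.neighborFinset u).erase v) (s₂ := (G.neighborFinset v).erase u))
      rw [Finset.card_erase_of_mem (by simpa using hv), card_neighborFinset_eq_degree] at h2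
      refine (Finset.sum_le_card_nsmul _ _ Y fun w hw => ?_).trans ?_
      · exact hY' w ((mem_neighborFinset ..).1 hw) (Or.inl hu)
      · rw [card_neighborFinset_eq_degree, smul_eq_mul]
        exact Nat.mul_le_mul_right _ (by omega)

lemma card_doubleStarTuples_le {a b c d : ℕ} (hca : c ≤ a) (hab : a ≤ b)
    (hG : ¬ Contains (doubleStar c d) G) :
    (doubleStarTuples G a b).card ≤
      max ((c + d) * ((c + d - 1).choose a * (c + d - 1 - a).choose b))
        (d * ((d - 1).choose a * (d - 1).choose b)) * Fintype.card V := by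
  rw [card_doubleStarTuples, mul_comm, ← smul_eq_mul, ← Finset.card_univ]
  exact Finset.sum_le_card_nsmul _ _ _ fun u _ => sum_card_leafPairs_le hca hab hG u

lemma not_contains_doubleStar_of_degree_le {c d : ℕ} (hG : ∀ v, G.degree v ≤ d) :
    ¬ Contains (doubleStar c d) G := by
  rw [contains_doubleStar_iff]
  rintro ⟨u, v, A, B, h⟩
  have h1 : leafPairs G c d u v = ∅ := leafPairs_eq_empty h.adj (Or.inr (hG v))
  have h2 := mem_doubleStarTuples.2 h
  simp [doubleStarTuples, h1] at h2

lemma card_doubleStarTuples_of_regular {a b d : ℕ} (hd : ∀ v, G.degree v = d)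
    (htri : ∀ u v w, G.Adj u v → G.Adj v w → ¬ G.Adj u w) :
    (doubleStarTuples G a b).card =
      d * ((d - 1).choose a * (d - 1).choose b) * Fintype.card V := by
  have hterm : ∀ u, ∀ v ∈ G.neighborFinset u,
      (leafPairs G a b u v).card = (d - 1).choose a * (d - 1).choose b := by
    intro u v hv
    rw [mem_neighborFinset] at hv
    rw [leafPairs, Finset.filter_true_of_mem, Finset.card_product, Finset.card_powersetCard,
      Finset.card_powersetCard, Finset.card_erase_of_mem (by simpa using hv),
      Finset.card_erase_of_mem (by simpa using hv.symm), card_neighborFinset_eq_degree,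
      card_neighborFinset_eq_degree, hd, hd]
    rintro ⟨A, B⟩ h
    simp only [Finset.mem_product, Finset.mem_powersetCard] at h
    rw [Finset.disjoint_left]
    intro x hxA hxB
    have h1 := h.1.1 hxA
    have h2 := h.2.1 hxB
    simp only [Finset.mem_erase, mem_neighborFinset] at h1 h2
    exact htri u v x hv h2.2 h1.2
  rw [card_doubleStarTuples]
  simp_rw [fun u => Finset.sum_congr rfl (hterm u)]
  simp only [Finset.sum_const, card_neighborFinset_eq_degree, hd, smul_eq_mul, Finset.card_univ]
  ring

end Counting

section Regular

/-- Integers of absolute value in `[d, d + d / 2)`, together with `n / 2` when `d` is odd: modulo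
`n`, a symmetric set of `d` residues in which no three elements sum to zero. -/
noncomputable def connectionSet (d n : ℕ) : Finset ℤ :=
  (Finset.Ico (d : ℤ) (d + d / 2) ∪ Finset.Ioc (-(d + d / 2) : ℤ) (-d)) ∪
    if Odd d then {(n / 2 : ℤ)} else ∅

lemma mem_connectionSet {d n : ℕ} {i : ℤ} : i ∈ connectionSet d n ↔
    ((d : ℤ) ≤ i ∧ i < d + d / 2) ∨ (-(d + d / 2) < i ∧ i ≤ -d) ∨ (d % 2 = 1 ∧ i = n / 2) := by
  rw [connectionSet]
  split_ifs with h
  · have := Nat.odd_iff.1 h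
    simp only [Finset.mem_union, Finset.mem_Ico, Finset.mem_Ioc, Finset.mem_singleton]
    tauto
  · have := fun h' => h (Nat.odd_iff.2 h')
    simp only [Finset.mem_union, Finset.mem_Ico, Finset.mem_Ioc, Finset.notMem_empty]
    tauto

lemma card_connectionSet {d n : ℕ} (hd : 0 < d) (hn : 10 * d ≤ n) :
    (connectionSet d n).card = d := by
  have h1 : Disjoint (Finset.Ico (d : ℤ) (d + d / 2)) (Finset.Ioc (-(d + d / 2) : ℤ) (-d)) := by
    rw [Finset.disjoint_left]
    simp only [Finset.mem_Ico, Finset.mem_Ioc]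
    omega
  rw [connectionSet]
  split_ifs with h
  · rw [Finset.card_union_of_disjoint, Finset.card_union_of_disjoint h1, Int.card_Ico,
      Int.card_Ioc, Finset.card_singleton]
    · have := Nat.odd_iff.1 h
      omega
    · rw [Finset.disjoint_singleton_right]
      simp only [Finset.mem_union, Finset.mem_Ico, Finset.mem_Ioc]
      omega
  · have := Nat.not_odd_iff.1 h
    rw [Finset.union_empty, Finset.card_union_of_disjoint h1, Int.card_Ico, Int.card_Ioc]
    omega

/-- For `n` large and `d * n` even, there is a triangle-free `d`-regular graph on `n` vertices. -/
lemma exists_regular_triangleFree {d n : ℕ} (hd : 0 < d) (hn : 10 * d ≤ n)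
    (heven : Even (d * n)) : ∃ G : SimpleGraph (Fin n),
      (∀ v, (G.neighborSet v).ncard = d) ∧ ∀ u v w, G.Adj u v → G.Adj v w → ¬ G.Adj u w := by
  obtain ⟨k, rfl⟩ : ∃ k, n = k + 1 := ⟨n - 1, by omega⟩
  set n := k + 1
  suffices h : ∃ G : SimpleGraph (ZMod n),
      (∀ v, (G.neighborSet v).ncard = d) ∧ ∀ u v w, G.Adj u v → G.Adj v w → ¬ G.Adj u w from h
  have hpar : d % 2 = 1 → n % 2 = 0 := by
    intro h
    rcases Nat.even_mul.1 heven with h' | h'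
    · have := Nat.even_iff.1 h'
      omega
    · exact Nat.even_iff.1 h'
  have small : ∀ {i : ℤ}, (n : ℤ) ∣ i → -n < i → i < n → i = 0 := by
    intro i hi h1 h2
    exact Int.eq_zero_of_abs_lt_dvd hi (abs_lt.2 ⟨h1, h2⟩)
  have hadd : ∀ {i j l : ℤ}, i ∈ connectionSet d n → j ∈ connectionSet d n →
      l ∈ connectionSet d n → ((i + j : ℤ) : ZMod n) ≠ (l : ℤ) := by
    intro i j l hi hj hl h
    rw [mem_connectionSet] at hi hj hl
    rw [ZMod.intCast_eq_intCast_iff_dvd_sub] at h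
    have := hpar
    obtain ⟨t, ht⟩ := h
    have ht1 : t < 2 := by
      by_contra! h2
      have : (n : ℤ) * 2 ≤ n * t := mul_le_mul_of_nonneg_left h2 (by omega)
      omega
    have ht2 : -2 < t := by
      by_contra! h2
      have : (n : ℤ) * t ≤ n * (-2) := mul_le_mul_of_nonneg_left h2 (by omega)
      omega
    interval_cases t <;> omega
  let G : SimpleGraph (ZMod n) :=
    { Adj := fun u v => ∃ i ∈ connectionSet d n, v = u + (i : ℤ)
      symm := ⟨by
        rintro u v ⟨i, hi, rfl⟩
        rw [mem_connectionSet] at hi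
        have hpar := hpar
        by_cases h : d % 2 = 1 ∧ i = n / 2
        · refine ⟨i, mem_connectionSet.2 (by tauto), ?_⟩
          have : ((n : ℤ) : ZMod n) = 0 := by simp
          have h2 : (n : ℤ) = i + i := by omega
          rw [h2, Int.cast_add] at this
          rw [add_assoc, this, add_zero]
        · refine ⟨-i, mem_connectionSet.2 (by omega), ?_⟩
          push_cast
          ring⟩
      loopless := ⟨by
        rintro u ⟨i, hi, h⟩
        have h0 : ((i : ℤ) : ZMod n) = 0 := by simpa using h.symm
        rw [mem_connectionSet] at hi
        have := small ((ZMod.intCast_zmod_eq_zero_iff_dvd _ _).1 h0) (by omega) (by omega)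
        omega⟩ }
  refine ⟨G, fun v => ?_, ?_⟩
  · have himage : G.neighborSet v =
        (fun i : ℤ => v + (i : ZMod n)) '' (connectionSet d n : Set ℤ) := by
      ext w
      simp only [mem_neighborSet, Set.mem_image, Finset.mem_coe, G]
      exact ⟨fun ⟨i, hi, h⟩ => ⟨i, hi, h.symm⟩, fun ⟨i, hi, h⟩ => ⟨i, hi, h.symm⟩⟩
    have hinj : Set.InjOn (fun i : ℤ => v + (i : ZMod n)) (connectionSet d n : Set ℤ) := by
      intro i hi j hj h
      have h' := (ZMod.intCast_eq_intCast_iff_dvd_sub _ _ _).1 (add_left_cancel h)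
      rw [Finset.mem_coe, mem_connectionSet] at hi hj
      have := small h' (by omega) (by omega)
      omega
    rw [himage, hinj.ncard_image, Set.ncard_coe_finset, card_connectionSet hd hn]
  · rintro u v w ⟨i, hi, rfl⟩ ⟨j, hj, rfl⟩ ⟨l, hl, h⟩
    refine hadd hi hj hl ?_
    push_cast
    rw [add_assoc] at h
    exact add_left_cancel h

end Regular

/-- If `r` is nice, then for large `n` with `dn` even,
`ex(n, S_{a,b}, S_{c,d}) = r·n`. -/
theorem exGen_doubleStar_doubleStar_nice (a b c d : ℕ) (hc : 0 < c)
    (hca : c ≤ a) (hab : a ≤ b) (hbd : b < d) (r : ℝ)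
    (hr : r = if a = b
      then max ((((c : ℝ) + d) / 2) * ((c + d - 1).choose a) * ((c + d - 1 - a).choose b))
               (((d : ℝ) / 2) * ((d - 1).choose a) * ((d - 1).choose b))
      else max (((c : ℝ) + d) * ((c + d - 1).choose a) * ((c + d - 1 - a).choose b))
               ((d : ℝ) * ((d - 1).choose a) * ((d - 1).choose b)))
    (hnice : r = (if a = b then (d : ℝ) / 2 else (d : ℝ)) *
      ((d - 1).choose a) * ((d - 1).choose b)) :
    ∃ n₀ : ℕ, ∀ n ≥ n₀, Even (d * n) →
      (exGen n (doubleStar a b) (doubleStar c d) : ℝ) = r * n := by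
  classical
  have ha : 0 < a := by omega
  have hb : 0 < b := by omega
  set R := d * ((d - 1).choose a * (d - 1).choose b) with hR
  have hrR : ((if a = b then 2 else 1 : ℕ) : ℝ) * r = R := by
    rw [hnice, hR]
    split_ifs <;> push_cast <;> ring
  have hmax : max ((c + d) * ((c + d - 1).choose a * (c + d - 1 - a).choose b)) R = R := by
    refine max_eq_right ?_
    rw [hr] at hnice
    have hle : ((c : ℝ) + d) * ((c + d - 1).choose a) * ((c + d - 1 - a).choose b) ≤
        (d : ℝ) * ((d - 1).choose a) * ((d - 1).choose b) := by
      split_ifs at hnice with h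
      · have := max_eq_right_iff.1 hnice
        linarith
      · exact max_eq_right_iff.1 hnice
    rw [hR, ← mul_assoc, ← mul_assoc]
    exact_mod_cast hle
  refine ⟨10 * d, fun n hn heven => ?_⟩
  obtain ⟨G₀, hreg, htri⟩ := exists_regular_triangleFree (by omega) hn heven
  have hdeg : ∀ v, G₀.degree v = d := by
    intro v
    rw [← card_neighborSet_eq_degree, ← Nat.card_eq_fintype_card, Nat.card_coe_set_eq, hreg]
  have hcopies : ∀ G : SimpleGraph (Fin n), (if a = b then 2 else 1) *
      _root_.copyCount (doubleStar a b) G = (doubleStarTuples G a b).card :=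
    fun G => (card_doubleStarTuples_eq_mul_copyCount ha hb).symm
  have hmul := hcopies G₀
  rw [card_doubleStarTuples_of_regular hdeg htri, Fintype.card_fin, ← hR] at hmul
  have hpos : 0 < if a = b then 2 else 1 := by split_ifs <;> norm_num
  have hgreatest : IsGreatest {N | ∃ G : SimpleGraph (Fin n), ¬ Contains (doubleStar c d) G ∧
      N = _root_.copyCount (doubleStar a b) G} (_root_.copyCount (doubleStar a b) G₀) := by
    refine ⟨⟨G₀, not_contains_doubleStar_of_degree_le fun v => (hdeg v).le, rfl⟩, ?_⟩
    rintro _ ⟨G, hG, rfl⟩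
    refine Nat.le_of_mul_le_mul_left ?_ hpos
    rw [hmul, hcopies, ← hmax]
    simpa only [Fintype.card_fin] using card_doubleStarTuples_le hca hab hG
  rw [exGen, hgreatest.csSup_eq]
  have hmul' : ((if a = b then 2 else 1 : ℕ) : ℝ) *
      (_root_.copyCount (doubleStar a b) G₀ : ℝ) = R * n := by exact_mod_cast hmul
  rw [← hrR, mul_assoc] at hmul'
  exact mul_left_cancel₀ (by exact_mod_cast hpos.ne') hmul'
end

section
/- Let 1/2 < β, 0 < α < 1/9 with 2α < 1−β, and let F be a graph with chromatic number three that has a color-critical edge. Then there exist a constant c = c(α,β,F) > 0 and n₀ = n₀(α,β,F) such that for every n ≥ n₀ the following holds: if t and Δ are positive integers with t ≤ αn and n/2 < Δ < βn, and G is an F-free graph on n vertices with maximum degree Δ such that G contains B_t but contains no B_{t+1} (i.e., the largest book in G is B_t), then G has at most Δ(n−Δ) − c·t·n edges. -/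
open SimpleGraph

/-- The book `B_t`: `t` triangles sharing a common edge; the common edge is `0-1` and
vertices `2,…,t+1` are the pages. -/
def book (t : ℕ) : SimpleGraph (Fin (t + 2)) :=
  SimpleGraph.fromRel (fun x y => x.val < 2 ∧ x ≠ y)

theorem exists_bicoloring_of_critical {U : Type*} [Fintype U] {F : SimpleGraph U}
    (hchr : F.chromaticNumber = 3)
    (hcc : ∃ e ∈ F.edgeSet, (F.deleteEdges {e}).chromaticNumber < F.chromaticNumber) :
    ∃ a b : U, F.Adj a b ∧ ∃ C : U → Fin 2, C a = C b ∧
      ∀ u w, F.Adj u w → s(u, w) ≠ s(a, b) → C u ≠ C w := by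
  obtain ⟨e, he, hlt⟩ := hcc
  induction e with | _ a b
  have hab : F.Adj a b := he
  rw [hchr] at hlt
  have h2 : (F.deleteEdges {s(a, b)}).Colorable 2 := by
    rw [← chromaticNumber_le_iff_colorable]
    exact Order.le_of_lt_add_one (hlt.trans_eq (by norm_num))
  obtain ⟨C⟩ := h2
  have hC : ∀ u w, F.Adj u w → s(u, w) ≠ s(a, b) → C u ≠ C w := fun u w h hne =>
    C.valid (by rw [deleteEdges_adj]; exact ⟨h, by simpa using hne⟩)
  refine ⟨a, b, hab, C, ?_, hC⟩
  by_contra hne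
  have hF : F.Colorable 2 := ⟨Coloring.mk C fun {u w} h => by
    by_cases hs : s(u, w) = s(a, b)
    · rcases Sym2.eq_iff.1 hs with ⟨rfl, rfl⟩ | ⟨rfl, rfl⟩
      · exact hne
      · exact Ne.symm hne
    · exact hC u w h hs⟩
  have := chromaticNumber_le_iff_colorable.2 hF
  rw [hchr] at this
  exact absurd this (by decide)

theorem contains_of_bicoloring {U V : Type*} [Fintype U] {F : SimpleGraph U} {G : SimpleGraph V}
    {a b : U} (hab : F.Adj a b) {C : U → Fin 2}
    (hC : C a = C b) (hCF : ∀ u w, F.Adj u w → s(u, w) ≠ s(a, b) → C u ≠ C w)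
    {x y : V} (hxy : G.Adj x y) {S T : Finset V}
    (hS : Fintype.card U ≤ S.card) (hT : Fintype.card U ≤ T.card) (hxS : x ∉ S) (hyS : y ∉ S)
    (hxT : ∀ z ∈ T, G.Adj x z) (hyT : ∀ z ∈ T, G.Adj y z)
    (hST : ∀ u ∈ S, ∀ z ∈ T, G.Adj u z) : Contains F G := by
  classical
  obtain ⟨p⟩ : Nonempty (U ↪ S) := Function.Embedding.nonempty_of_card_le (by simpa using hS)
  obtain ⟨q⟩ : Nonempty (U ↪ T) := Function.Embedding.nonempty_of_card_le (by simpa using hT)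
  let g : U → V := fun u => if C u = C a then
    (if u = a then x else if u = b then y else p u) else q u
  have hg : ∀ u, C u = C a → g u = x ∨ g u = y ∨ g u ∈ S := by
    intro u hu
    simp only [g, hu, if_true]
    split_ifs <;> simp
  have hgS : ∀ u, C u = C a → ∀ z ∈ T, G.Adj (g u) z := by
    intro u hu z hz
    rcases hg u hu with h | h | h
    · rw [h]; exact hxT z hz
    · rw [h]; exact hyT z hz
    · exact hST _ h z hz
  have hgT : ∀ u, C u ≠ C a → g u ∈ T := by
    intro u hu
    simp [g, hu]
  have hga : g a = x := by simp [g]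
  have hgb : g b = y := by simp [g, hC, hab.ne']
  refine ⟨⟨g, fun {u w} h => ?_⟩, fun u w h => ?_⟩
  · by_cases hs : s(u, w) = s(a, b)
    · rcases Sym2.eq_iff.1 hs with ⟨rfl, rfl⟩ | ⟨rfl, rfl⟩
      · rw [hga, hgb]; exact hxy
      · rw [hga, hgb]; exact hxy.symm
    · have hne := hCF u w h hs
      by_cases hu : C u = C a
      · exact hgS u hu _ (hgT w (hu ▸ hne.symm))
      · have hw : C w = C a := by omega
        exact (hgS w hw _ (hgT u hu)).symm
  · change g u = g w at h
    by_cases hu : C u = C a <;> by_cases hw : C w = C a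
    · have hx : ∀ i, (p i : V) ≠ x := fun i hi => hxS (hi ▸ (p i).2)
      have hy : ∀ i, (p i : V) ≠ y := fun i hi => hyS (hi ▸ (p i).2)
      have hxy' := hxy.ne
      simp only [g, hu, hw, if_true] at h
      split_ifs at h <;> simp_all [eq_comm]
    · exact absurd (h ▸ hgS u hu (g w) (hgT w hw)) (G.loopless.irrefl _)
    · exact absurd (h ▸ hgS w hw (g u) (hgT u hu)) (G.loopless.irrefl _)
    · simp only [g, hu, hw, if_false] at h
      exact q.injective (Subtype.ext h)

theorem contains_book_iff {V : Type*} {G : SimpleGraph V} {t : ℕ} :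
    Contains (book t) G ↔ ∃ x y, G.Adj x y ∧ ∃ T : Finset V, T.card = t ∧
      ∀ z ∈ T, G.Adj x z ∧ G.Adj y z := by
  constructor
  · rintro ⟨f, hf⟩
    have hadj : ∀ i j : Fin (t + 2), i.val < 2 → i ≠ j → G.Adj (f i) (f j) := fun i j h hij =>
      f.map_rel (by
        simp only [book, fromRel_adj]
        exact ⟨hij, Or.inl ⟨h, hij⟩⟩)
    refine ⟨f 0, f 1, hadj 0 1 (by simp) (by simp),
      Finset.univ.map ⟨fun i : Fin t => f (i.natAdd 2 |>.cast (by omega)), ?_⟩, by simp, ?_⟩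
    · intro i j h
      have := hf h
      simpa [Fin.ext_iff] using this
    · simp only [Finset.mem_map, Finset.mem_univ, true_and]
      rintro z ⟨i, rfl⟩
      exact ⟨hadj _ _ (by simp) (by simp [Fin.ext_iff]),
        hadj _ _ (by simp) (by simp [Fin.ext_iff])⟩
  · rintro ⟨x, y, hxy, T, hT, hz⟩
    let e : Fin t ≃ T := (T.equivFinOfCardEq hT).symm
    let g : Fin (t + 2) → V := fun i => if h : 2 ≤ i.val then e ⟨i.val - 2, by omega⟩
      else if i.val = 0 then x else y
    have hgT : ∀ i : Fin (t + 2), 2 ≤ i.val → g i ∈ T := fun i h => by simp [g, h]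
    have hg0 : ∀ i : Fin (t + 2), i.val = 0 → g i = x := fun i h => by
      simp only [g]
      rw [dif_neg (by omega), if_pos h]
    have hg1 : ∀ i : Fin (t + 2), i.val = 1 → g i = y := fun i h => by
      simp only [g]
      rw [dif_neg (by omega), if_neg (by omega)]
    have key : ∀ i j : Fin (t + 2), i.val < 2 → i.val < j.val → G.Adj (g i) (g j) := by
      intro i j hi hij
      obtain h | h : i.val = 0 ∨ i.val = 1 := by omega
      · rw [hg0 i h]
        by_cases hj : j.val = 1
        · rw [hg1 j hj]; exact hxy
        · exact (hz _ (hgT j (by omega))).1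
      · rw [hg1 i h]
        exact (hz _ (hgT j (by omega))).2
    refine ⟨⟨g, fun {i j} h => ?_⟩, fun i j h => ?_⟩
    · simp only [book, fromRel_adj] at h
      have hne : i.val ≠ j.val := fun hh => h.1 (Fin.ext hh)
      rcases lt_or_gt_of_ne hne with hlt | hlt
      · exact key i j (by omega) hlt
      · exact (key j i (by omega) hlt).symm
    · change g i = g j at h
      by_contra hne
      have hne : i.val ≠ j.val := fun hh => hne (Fin.ext hh)
      by_cases h2 : i.val < 2 ∨ j.val < 2
      · rcases lt_or_gt_of_ne hne with hlt | hlt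
        · exact (key i j (by omega) hlt).ne h
        · exact (key j i (by omega) hlt).ne h.symm
      · have hi : 2 ≤ i.val := by omega
        have hj : 2 ≤ j.val := by omega
        simp only [g, hi, hj, dif_pos] at h
        have := e.injective (Subtype.ext h)
        simp only [Fin.mk.injEq] at this
        omega

open Classical in
theorem sum_card_adj_le_of_no_biclique {V : Type*} [Fintype V] {G : SimpleGraph V}
    (A : Finset V) {s M : ℕ} {ε : ℝ} (hs : 0 < s) (hM : 2 * s ≤ M * ε)
    (hV : M * 2 ^ M * s < Fintype.card V)
    (hG : ∀ S ⊆ A, ∀ T ⊆ A, s ≤ S.card → s ≤ T.card → ∃ u ∈ S, ∃ w ∈ T, ¬ G.Adj u w) :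
    ∑ x ∈ A, (({y ∈ A | G.Adj x y}.card : ℕ) : ℝ) ≤
      M * Fintype.card V + ε * (Fintype.card V) ^ 2 := by
  set n := Fintype.card V with hn
  have hcard : ∀ X : Finset V, X.card ≤ n := fun X => X.card_le_univ
  have hn0 : (0 : ℝ) < n := by exact_mod_cast (Nat.zero_le _).trans_lt hV
  have hs0 : (0 : ℝ) < s := by exact_mod_cast hs
  have hM0 : (0 : ℝ) < M := by
    rcases Nat.eq_zero_or_pos M with rfl | h
    · norm_num at hM; linarith
    · exact_mod_cast h
  have hε : 0 < ε := by
    by_contra h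
    nlinarith
  set D := {x ∈ A | ε * n ≤ ({y ∈ A | G.Adj x y}.card : ℝ)} with hD
  have hDM : D.card < M := by
    by_contra! hle
    obtain ⟨D', hD'D, hD'⟩ := Finset.exists_subset_card_eq hle
    set W := {w ∈ A | s ≤ {x ∈ D' | G.Adj x w}.card} with hW
    have h1 : M * (ε * n) ≤ ∑ x ∈ D', (({y ∈ A | G.Adj x y}.card : ℕ) : ℝ) := by
      rw [← hD', ← nsmul_eq_mul]
      exact Finset.card_nsmul_le_sum _ _ _ fun x hx => (Finset.mem_filter.1 (hD'D hx)).2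
    have h2 : ∑ x ∈ D', {y ∈ A | G.Adj x y}.card = ∑ y ∈ A, {x ∈ D' | G.Adj x y}.card :=
      Finset.sum_card_bipartiteAbove_eq_sum_card_bipartiteBelow _
    have h3 : ∑ y ∈ A, {x ∈ D' | G.Adj x y}.card ≤ s * n + M * W.card := by
      calc _ ≤ ∑ y ∈ A, (s + if y ∈ W then M else 0) := by
            refine Finset.sum_le_sum fun y hy => ?_
            split_ifs with h
            · exact (Finset.card_filter_le _ _).trans (by omega)
            · simp only [hW, Finset.mem_filter, hy, true_and] at h
              omega
        _ = A.card * s + (A.filter (· ∈ W)).card * M := by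
            rw [Finset.sum_add_distrib, ← Finset.sum_filter]
            simp
        _ ≤ _ := by
            have : (A.filter (· ∈ W)).card ≤ W.card :=
              Finset.card_le_card fun y hy => (Finset.mem_filter.1 hy).2
            nlinarith [hcard A]
    have h4 : s * n ≤ M * W.card := by
      have h5 : (M : ℝ) * (ε * n) ≤ s * n + M * W.card := by
        refine h1.trans ?_
        exact_mod_cast h2.trans_le h3
      have : (s : ℝ) * n ≤ M * W.card := by nlinarith
      exact_mod_cast this
    have h6 : D'.powerset.card * s < W.card := by
      rw [Finset.card_powerset, hD']
      have h7 : M * 2 ^ M * s < M * W.card := hV.trans_le (by nlinarith)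
      rw [mul_assoc] at h7
      exact Nat.lt_of_mul_lt_mul_left h7
    obtain ⟨S, hS, hfib⟩ := Finset.exists_lt_card_fiber_of_mul_lt_card_of_maps_to
      (f := fun w => {x ∈ D' | G.Adj x w}) (fun w _ => by simp) h6
    have hSD : S ⊆ D' := Finset.mem_powerset.1 hS
    obtain ⟨w, hw⟩ := Finset.card_pos.1 ((Nat.zero_le _).trans_lt hfib)
    simp only [Finset.mem_filter, hW] at hw
    obtain ⟨u, hu, z, hz, hadj⟩ := hG S (fun x hx => (Finset.mem_filter.1 (hD'D (hSD hx))).1)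
      {w ∈ W | {x ∈ D' | G.Adj x w} = S}
      (fun w hw => (Finset.mem_filter.1 (Finset.mem_filter.1 hw).1).1)
      (hw.2 ▸ hw.1.2) hfib.le
    have hz' := (Finset.mem_filter.1 hz).2
    rw [← hz'] at hu
    exact hadj (Finset.mem_filter.1 hu).2
  calc _ ≤ ∑ x ∈ A, ((if x ∈ D then (n : ℝ) else 0) + ε * n) := by
        refine Finset.sum_le_sum fun x hx => ?_
        split_ifs with h
        · have : ({y ∈ A | G.Adj x y}.card : ℝ) ≤ n := by exact_mod_cast hcard _
          nlinarith
        · simp only [hD, Finset.mem_filter, hx, true_and, not_le] at h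
          linarith
    _ = (A.filter (· ∈ D)).card * n + A.card * (ε * n) := by
        rw [Finset.sum_add_distrib, ← Finset.sum_filter]
        simp
    _ ≤ _ := by
        have h1 : (A.filter (· ∈ D)).card ≤ M :=
          (Finset.card_le_card fun y hy => (Finset.mem_filter.1 hy).2).trans hDM.le
        have h1' : ((A.filter (· ∈ D)).card : ℝ) ≤ M := by exact_mod_cast h1
        have h2 : (A.card : ℝ) ≤ n := by exact_mod_cast hcard A
        have h3 : 0 < ε * n := by positivity
        nlinarith

/-- The number of non-neighbours of `z` on the opposite side of the bipartition `A`, `Aᶜ`. -/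
noncomputable def oppositeNonadj {V : Type*} [Fintype V] (G : SimpleGraph V) (A : Finset V)
    (z : V) : ℕ :=
  {y | (y ∈ A ↔ z ∉ A) ∧ ¬ G.Adj z y}.ncard

open Classical in
theorem oppositeNonadj_of_mem {V : Type*} [Fintype V] {G : SimpleGraph V} {A : Finset V} {z : V}
    (hz : z ∈ A) : oppositeNonadj G A z = {y ∈ Aᶜ | ¬ G.Adj z y}.card := by
  rw [oppositeNonadj, ← Set.ncard_coe_finset]
  congr 1; ext y; simp [hz]

open Classical in
theorem oppositeNonadj_of_notMem {V : Type*} [Fintype V] {G : SimpleGraph V} {A : Finset V}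
    {z : V} (hz : z ∉ A) : oppositeNonadj G A z = {y ∈ A | ¬ G.Adj z y}.card := by
  rw [oppositeNonadj, ← Set.ncard_coe_finset]
  congr 1; ext y; simp [hz]

open Classical in
theorem oppositeNonadj_compl {V : Type*} [Fintype V] {G : SimpleGraph V} {A : Finset V} (z : V) :
    oppositeNonadj G Aᶜ z = oppositeNonadj G A z := by
  by_cases hz : z ∈ A
  · rw [oppositeNonadj_of_mem hz, oppositeNonadj_of_notMem (by simpa using hz)]
  · rw [oppositeNonadj_of_notMem hz, oppositeNonadj_of_mem (by simpa using hz), compl_compl]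

open Classical in
theorem sum_oppositeNonadj_compl {V : Type*} [Fintype V] {G : SimpleGraph V} (A : Finset V) :
    ∑ z ∈ Aᶜ, oppositeNonadj G A z = ∑ z ∈ A, oppositeNonadj G A z := by
  rw [Finset.sum_congr rfl fun z hz => oppositeNonadj_of_notMem (by simpa using hz),
    Finset.sum_congr (rfl : A = A) fun z hz => oppositeNonadj_of_mem hz]
  refine (Finset.sum_card_bipartiteAbove_eq_sum_card_bipartiteBelow fun z y => ¬ G.Adj z y).trans
    (Finset.sum_congr rfl fun z _ => ?_)
  simp only [Finset.bipartiteBelow, G.adj_comm z]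

open Classical in
theorem two_mul_card_edgeFinset_add_le {V : Type*} [Fintype V] {G : SimpleGraph V}
    {A : Finset V} (hdeg : ∀ v, G.degree v ≤ A.card) :
    2 * G.edgeFinset.card + ∑ z ∈ A, oppositeNonadj G A z ≤
      2 * (A.card * Aᶜ.card) + ∑ x ∈ A, {y ∈ A | G.Adj x y}.card := by
  have hsplit : ∀ v, G.degree v = {y ∈ A | G.Adj v y}.card + {y ∈ Aᶜ | G.Adj v y}.card := by
    intro v
    rw [← G.card_neighborFinset_eq_degree, ← Finset.card_union_of_disjoint]
    · congr 1; ext y; by_cases hy : y ∈ A <;> simp [hy]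
    · exact Finset.disjoint_filter_filter disjoint_compl_right
  have h1 : ∑ v ∈ A, G.degree v + ∑ v ∈ Aᶜ, G.degree v = 2 * G.edgeFinset.card := by
    rw [Finset.sum_add_sum_compl, G.sum_degrees_eq_twice_card_edges]
  have h2 : ∑ v ∈ Aᶜ, G.degree v ≤ Aᶜ.card * A.card :=
    (Finset.sum_le_card_nsmul _ _ _ fun v _ => hdeg v).trans_eq (by simp)
  have h3 : ∑ z ∈ A, oppositeNonadj G A z + ∑ z ∈ A, {y ∈ Aᶜ | G.Adj z y}.card =
      A.card * Aᶜ.card := by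
    rw [← Finset.sum_add_distrib, ← smul_eq_mul, ← Finset.sum_const]
    refine Finset.sum_congr rfl fun z hz => ?_
    rw [oppositeNonadj_of_mem hz, add_comm, Finset.card_filter_add_card_filter_not]
  have h4 : ∑ z ∈ Aᶜ, {y ∈ A | G.Adj z y}.card = ∑ z ∈ A, {y ∈ Aᶜ | G.Adj z y}.card := by
    refine (Finset.sum_card_bipartiteAbove_eq_sum_card_bipartiteBelow fun z y => G.Adj z y).trans
      (Finset.sum_congr rfl fun z _ => ?_)
    simp only [Finset.bipartiteBelow, G.adj_comm z]
  simp only [hsplit, Finset.sum_add_distrib] at h1 h2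
  rw [mul_comm] at h2
  omega

open Classical in
theorem sum_card_adj_mul_card_compl_le {V : Type*} [Fintype V] {G : SimpleGraph V}
    {A : Finset V} {t : ℕ} (ht : ∀ x ∈ A, {y ∈ A | G.Adj x y}.card ≤ t)
    (hcod : ∀ x y, G.Adj x y → {z | G.Adj x z ∧ G.Adj y z}.ncard ≤ t) :
    (∑ x ∈ A, {y ∈ A | G.Adj x y}.card) * Aᶜ.card ≤
      2 * t * ∑ z ∈ A, oppositeNonadj G A z + (∑ x ∈ A, {y ∈ A | G.Adj x y}.card) * t := by
  have key : ∀ x ∈ A, ∀ y ∈ {y ∈ A | G.Adj x y},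
      Aᶜ.card ≤ oppositeNonadj G A x + oppositeNonadj G A y + t := by
    intro x hx y hy
    simp only [Finset.mem_filter] at hy
    rw [oppositeNonadj_of_mem hx, oppositeNonadj_of_mem hy.1]
    have h := hcod x y hy.2
    rw [← Finset.coe_filter_univ, Set.ncard_coe_finset] at h
    calc Aᶜ.card ≤ (({z ∈ Aᶜ | ¬ G.Adj x z} ∪ {z ∈ Aᶜ | ¬ G.Adj y z}) ∪
          ({z | G.Adj x z ∧ G.Adj y z} : Finset V)).card := by
          refine Finset.card_le_card fun z hz => ?_
          simp only [Finset.mem_union, Finset.mem_filter, hz, Finset.mem_univ, true_and]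
          tauto
      _ ≤ _ := (Finset.card_union_le _ _).trans (Nat.add_le_add (Finset.card_union_le _ _) h)
  have hfst : ∑ x ∈ A, ∑ y ∈ A with G.Adj x y, oppositeNonadj G A x ≤
      t * ∑ z ∈ A, oppositeNonadj G A z := by
    rw [Finset.mul_sum]
    refine Finset.sum_le_sum fun x hx => ?_
    rw [Finset.sum_const, smul_eq_mul]
    exact Nat.mul_le_mul_right _ (ht x hx)
  have hsnd : ∑ x ∈ A, ∑ y ∈ A with G.Adj x y, oppositeNonadj G A y =
      ∑ x ∈ A, ∑ y ∈ A with G.Adj x y, oppositeNonadj G A x :=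
    Finset.sum_comm' (by simp [G.adj_comm]; tauto)
  calc _ = ∑ x ∈ A, ∑ y ∈ A with G.Adj x y, Aᶜ.card := by
        simp [Finset.sum_mul]
    _ ≤ ∑ x ∈ A, ∑ y ∈ A with G.Adj x y, (oppositeNonadj G A x + oppositeNonadj G A y + t) :=
        Finset.sum_le_sum fun x hx => Finset.sum_le_sum fun y hy => key x hx y hy
    _ = ∑ x ∈ A, ∑ y ∈ A with G.Adj x y, oppositeNonadj G A x +
        ∑ x ∈ A, ∑ y ∈ A with G.Adj x y, oppositeNonadj G A y +
        (∑ x ∈ A, {y ∈ A | G.Adj x y}.card) * t := by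
        simp [Finset.sum_add_distrib, Finset.sum_mul]
    _ ≤ _ := by
        rw [hsnd]; linarith

open Classical in
theorem card_compl_sub_le_card_common {V : Type*} [Fintype V] {G : SimpleGraph V}
    {A T : Finset V} {μ : ℝ} (hTA : T ⊆ A) (hT : ∀ z ∈ T, (oppositeNonadj G A z : ℝ) ≤ μ) :
    (Aᶜ.card : ℝ) - T.card * μ ≤ ({y ∈ Aᶜ | ∀ z ∈ T, G.Adj z y}.card : ℕ) := by
  have h1 : Aᶜ.card ≤ {y ∈ Aᶜ | ∀ z ∈ T, G.Adj z y}.card + ∑ z ∈ T, oppositeNonadj G A z := by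
    calc Aᶜ.card ≤ ({y ∈ Aᶜ | ∀ z ∈ T, G.Adj z y} ∪
          T.biUnion fun z => {y ∈ Aᶜ | ¬ G.Adj z y}).card := by
          refine Finset.card_le_card fun y hy => ?_
          simp only [Finset.mem_union, Finset.mem_filter, hy, true_and, Finset.mem_biUnion]
          by_contra! h
          obtain ⟨z, hz, hzy⟩ := h.1
          exact hzy (h.2 z hz)
      _ ≤ {y ∈ Aᶜ | ∀ z ∈ T, G.Adj z y}.card + ∑ z ∈ T, {y ∈ Aᶜ | ¬ G.Adj z y}.card :=
          (Finset.card_union_le _ _).trans (Nat.add_le_add_left Finset.card_biUnion_le _)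
      _ = _ := by
          congr 1
          exact Finset.sum_congr rfl fun z hz => (oppositeNonadj_of_mem (hTA hz)).symm
  have h2 : ∑ z ∈ T, (oppositeNonadj G A z : ℝ) ≤ T.card * μ := by
    rw [← nsmul_eq_mul]
    exact Finset.sum_le_card_nsmul _ _ _ hT
  have h3 : (Aᶜ.card : ℝ) ≤ ({y ∈ Aᶜ | ∀ z ∈ T, G.Adj z y}.card : ℕ) +
      ∑ z ∈ T, (oppositeNonadj G A z : ℝ) := by exact_mod_cast h1
  linarith

open Classical in
theorem card_filter_oppositeNonadj_lt {V : Type*} [Fintype V] {G : SimpleGraph V} {s : ℕ}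
    (hfree : ∀ x y, G.Adj x y → ∀ S T : Finset V, s ≤ S.card → s ≤ T.card → x ∉ S → y ∉ S →
      (∀ z ∈ T, G.Adj x z) → (∀ z ∈ T, G.Adj y z) → ¬ ∀ u ∈ S, ∀ z ∈ T, G.Adj u z)
    {A : Finset V} {μ : ℝ} (hA : s * μ + s + 2 ≤ Aᶜ.card) {x y : V} (hxy : G.Adj x y)
    {T : Finset V} (hT : ∀ z ∈ T, G.Adj x z ∧ G.Adj y z) :
    {z ∈ T | z ∈ A ∧ (oppositeNonadj G A z : ℝ) ≤ μ}.card < s := by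
  by_contra! hle
  obtain ⟨T', hT', hcard⟩ := Finset.exists_subset_card_eq hle
  have hmem : ∀ z ∈ T', z ∈ T ∧ z ∈ A ∧ (oppositeNonadj G A z : ℝ) ≤ μ := fun z hz =>
    Finset.mem_filter.1 (hT' hz)
  have h1 := card_compl_sub_le_card_common (G := G) (fun z hz => (hmem z hz).2.1)
    (fun z hz => (hmem z hz).2.2)
  rw [hcard] at h1
  set S := {w ∈ Aᶜ | ∀ z ∈ T', G.Adj z w} with hS
  have h2 : s + 2 ≤ S.card := by
    have : (s : ℝ) + 2 ≤ S.card := by linarith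
    exact_mod_cast this
  have h3 : s ≤ (S \ {x, y}).card := by
    have := Finset.le_card_sdiff {x, y} S
    have := Finset.card_le_two (a := x) (b := y)
    omega
  refine hfree x y hxy (S \ {x, y}) T' h3 hcard.ge (by simp) (by simp)
    (fun z hz => (hT z (hmem z hz).1).1) (fun z hz => (hT z (hmem z hz).1).2) fun u hu z hz => ?_
  exact ((Finset.mem_filter.1 (Finset.mem_sdiff.1 hu).1).2 z hz).symm

open Classical in
theorem exists_oppositeNonadj_gt_of_adj {V : Type*} [Fintype V] {G : SimpleGraph V} {t : ℕ}
    (hcod : ∀ x y, G.Adj x y → {z | G.Adj x z ∧ G.Adj y z}.ncard ≤ t)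
    {A : Finset V} {μ : ℝ} (hA : 2 * μ + t < Aᶜ.card) {x y : V} (hxy : G.Adj x y)
    (hx : x ∈ A) (hy : y ∈ A) :
    μ < oppositeNonadj G A x ∨ μ < oppositeNonadj G A y := by
  by_contra! h
  have h1 := card_compl_sub_le_card_common (G := G) (A := A) (T := {x, y}) (μ := μ)
    (by simp [Finset.insert_subset_iff, hx, hy]) (by simp [h.1, h.2])
  rw [Finset.card_pair hxy.ne] at h1
  have h2 := hcod x y hxy
  rw [← Finset.coe_filter_univ, Set.ncard_coe_finset] at h2
  have h3 : ({w ∈ Aᶜ | ∀ z ∈ ({x, y} : Finset V), G.Adj z w}.card : ℕ) ≤ t :=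
    (Finset.card_le_card fun w hw => by simpa using (Finset.mem_filter.1 hw).2).trans h2
  have h4 : (({w ∈ Aᶜ | ∀ z ∈ ({x, y} : Finset V), G.Adj z w}.card : ℕ) : ℝ) ≤ t := by
    exact_mod_cast h3
  push_cast at h1
  linarith

open Classical in
theorem mul_le_sum_oppositeNonadj {V : Type*} [Fintype V] {G : SimpleGraph V} {s t : ℕ}
    (hs : 2 ≤ s) (ht : 0 < t)
    (hfree : ∀ x y, G.Adj x y → ∀ S T : Finset V, s ≤ S.card → s ≤ T.card → x ∉ S → y ∉ S →
      (∀ z ∈ T, G.Adj x z) → (∀ z ∈ T, G.Adj y z) → ¬ ∀ u ∈ S, ∀ z ∈ T, G.Adj u z)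
    (hcod : ∀ x y, G.Adj x y → {z | G.Adj x z ∧ G.Adj y z}.ncard ≤ t)
    {A : Finset V} {μ : ℝ} (hμ : 0 < μ) (hA : s * μ + 4 * s + 2 ≤ A.card)
    (hA' : s * μ + 4 * s + 2 ≤ Aᶜ.card) {x y : V} (hxy : G.Adj x y)
    {T : Finset V} (hT : ∀ z ∈ T, G.Adj x z ∧ G.Adj y z) (hTt : T.card = t) :
    μ * t ≤ 8 * s * ((∑ z ∈ A, oppositeNonadj G A z : ℕ) : ℝ) := by
  set f := ∑ z ∈ A, oppositeNonadj G A z with hf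
  set D : Finset V := {z | μ < (oppositeNonadj G A z : ℝ)} with hD
  have hs' : (2 : ℝ) ≤ s := by exact_mod_cast hs
  have hDf : μ * D.card ≤ 2 * (f : ℝ) := by
    have h1 : D.card • μ ≤ ∑ z ∈ D, (oppositeNonadj G A z : ℝ) :=
      Finset.card_nsmul_le_sum _ _ _ fun z hz => (Finset.mem_filter.1 hz).2.le
    have h2 : ∑ z ∈ D, oppositeNonadj G A z ≤ 2 * f := by
      calc _ ≤ ∑ z, oppositeNonadj G A z := Finset.sum_le_sum_of_subset (Finset.subset_univ _)
        _ = 2 * f := by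
          rw [← Finset.sum_add_sum_compl A, sum_oppositeNonadj_compl, two_mul]
    have h3 : ∑ z ∈ D, (oppositeNonadj G A z : ℝ) ≤ 2 * f := by exact_mod_cast h2
    rw [nsmul_eq_mul] at h1
    linarith
  have ht0 : (0 : ℝ) < t := by exact_mod_cast ht
  rcases le_or_gt (4 * s) t with hst | hst
  · have h1 := card_filter_oppositeNonadj_lt hfree (by linarith) hxy hT (A := A) (μ := μ)
    have h2 := card_filter_oppositeNonadj_lt hfree (A := Aᶜ) (μ := μ)
      (by rw [compl_compl]; linarith) hxy hT
    simp only [oppositeNonadj_compl] at h2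
    have h3 : T.card ≤ {z ∈ T | z ∈ A ∧ (oppositeNonadj G A z : ℝ) ≤ μ}.card +
        {z ∈ T | z ∈ Aᶜ ∧ (oppositeNonadj G A z : ℝ) ≤ μ}.card + D.card := by
      refine le_trans (Finset.card_le_card fun z hz => ?_) ((Finset.card_union_le _ D).trans
        (Nat.add_le_add_right (Finset.card_union_le _ _) _))
      simp only [Finset.mem_union, Finset.mem_filter, hz, true_and, hD, Finset.mem_univ,
        Finset.mem_compl]
      by_cases hzA : z ∈ A <;> simp [hzA, le_or_gt]
    have h4 : t ≤ 2 * D.card := by omega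
    have h5 : (t : ℝ) ≤ 2 * D.card := by exact_mod_cast h4
    have h6 : (0 : ℝ) ≤ f := Nat.cast_nonneg _
    nlinarith
  · have hbad : ∀ u w, G.Adj u w → (u ∈ A ↔ w ∈ A) → D.Nonempty := by
      intro u w huw hiff
      have hst' : (t : ℝ) < 4 * s := by exact_mod_cast hst
      have h2s : 2 * μ ≤ s * μ := by nlinarith
      have : μ < oppositeNonadj G A u ∨ μ < oppositeNonadj G A w := by
        by_cases hu : u ∈ A
        · exact exists_oppositeNonadj_gt_of_adj hcod (by linarith) huw hu (hiff.1 hu)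
        · have := exists_oppositeNonadj_gt_of_adj hcod (A := Aᶜ) (μ := μ)
            (by rw [compl_compl]; linarith) huw (by simpa using hu)
            (by simpa using fun h => hu (hiff.2 h))
          simpa only [oppositeNonadj_compl] using this
      rcases this with h | h
      · exact ⟨u, by simpa [hD] using h⟩
      · exact ⟨w, by simpa [hD] using h⟩
    obtain ⟨z, hz⟩ : T.Nonempty := Finset.card_pos.1 (hTt ▸ ht)
    have hDne : D.Nonempty := by
      by_cases h1 : x ∈ A ↔ y ∈ A
      · exact hbad x y hxy h1
      by_cases h2 : x ∈ A ↔ z ∈ A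
      · exact hbad x z (hT z hz).1 h2
      · exact hbad y z (hT z hz).2 (by tauto)
    have h1 : (1 : ℝ) ≤ D.card := by exact_mod_cast hDne.card_pos
    have h2 : (t : ℝ) ≤ 4 * s := by exact_mod_cast hst.le
    have h3 : μ ≤ 2 * f := by nlinarith
    nlinarith

theorem le_half_of_mul_le {s t n M β γ ε E f : ℝ} (hs : 0 < s) (hγ : 0 < γ) (hn : 0 < n)
    (hεs : 160 * s * ε = γ * (1 - β)) (hnM : M ≤ ε * n) (ht : (1 - β) * n ≤ 5 * t)
    (hf : γ * n * t ≤ 8 * s * f) (hE : E ≤ M * n + ε * n ^ 2) : E ≤ f / 2 := by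
  have h1 : M * n ≤ ε * n * n := by gcongr
  have h2 : γ * n * ((1 - β) * n) ≤ γ * n * (5 * t) := by gcongr
  have h3 : γ * n * ((1 - β) * n) = 160 * s * ε * n ^ 2 := by rw [hεs]; ring
  have h4 : s * (4 * ε * n ^ 2) ≤ s * f := by linarith
  have h5 := le_of_mul_le_mul_left h4 hs
  linarith

open Classical in
theorem ncard_edgeSet_le_of_book {U V : Type*} [Fintype U] [Fintype V] {F : SimpleGraph U}
    {G : SimpleGraph V} {a b : U} (hab : F.Adj a b) {C : U → Fin 2} (hCab : C a = C b)
    (hC : ∀ u w, F.Adj u w → s(u, w) ≠ s(a, b) → C u ≠ C w)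
    {n s M t Δ : ℕ} {β γ ε : ℝ} (hV : n = Fintype.card V) (hs : s = Fintype.card U + 2)
    (hβ : 1 / 2 < β) (hγ0 : 0 < γ) (hγs : s * γ = (1 - β) / 2)
    (hεs : 160 * s * ε = γ * (1 - β)) (hM : 2 * s ≤ M * ε)
    (hnM : M * 2 ^ M * s < n) (hn₁ : 8 * s + 4 ≤ (1 - β) * n) (hn₂ : M ≤ ε * n)
    (ht : 0 < t) (hΔn : (n : ℝ) / 2 < Δ) (hΔβ : Δ < β * n) (hfree : ¬ Contains F G)
    (hdeg : ∀ v, (G.neighborSet v).ncard ≤ Δ) (hmax : ∃ v, (G.neighborSet v).ncard = Δ)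
    (hbook : Contains (book t) G) (hbook' : ¬ Contains (book (t + 1)) G) :
    (G.edgeSet.ncard : ℝ) ≤ Δ * ((n : ℝ) - Δ) - γ / (32 * s) * t * n := by
  obtain ⟨v, hv⟩ := hmax
  have hs0 : (0 : ℝ) < s := by exact_mod_cast (by omega : 0 < s)
  have hn0 : (0 : ℝ) < n := by exact_mod_cast (Nat.zero_le _).trans_lt hnM
  have hcod : ∀ x y, G.Adj x y → {z | G.Adj x z ∧ G.Adj y z}.ncard ≤ t := by
    intro x y hxy
    rw [← Finset.coe_filter_univ, Set.ncard_coe_finset]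
    by_contra! hlt
    obtain ⟨T, hT, hTt⟩ := Finset.exists_subset_card_eq (Nat.succ_le_of_lt hlt)
    exact hbook' (contains_book_iff.2
      ⟨x, y, hxy, T, hTt, fun z hz => (Finset.mem_filter.1 (hT hz)).2⟩)
  have hfree' : ∀ x y, G.Adj x y → ∀ S T : Finset V, Fintype.card U ≤ S.card →
      Fintype.card U ≤ T.card → x ∉ S → y ∉ S → (∀ z ∈ T, G.Adj x z) → (∀ z ∈ T, G.Adj y z) →
      ¬ ∀ u ∈ S, ∀ z ∈ T, G.Adj u z := fun x y hxy S T hS hT hxS hyS hxT hyT hST =>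
    hfree (contains_of_bicoloring hab hCab hC hxy hS hT hxS hyS hxT hyT hST)
  set A := G.neighborFinset v with hA
  have hAv : ∀ x, x ∈ A ↔ G.Adj v x := fun x => G.mem_neighborFinset v x
  have hncard : ∀ w, (G.neighborSet w).ncard = G.degree w := fun w => by
    rw [Set.ncard_eq_toFinset_card', ← G.card_neighborFinset_eq_degree]; rfl
  have hAΔ : A.card = Δ := by rw [hA, G.card_neighborFinset_eq_degree, ← hncard, hv]
  have hAΔ' : (A.card : ℝ) = Δ := by rw [hAΔ]
  have hB : (Aᶜ.card : ℝ) = n - Δ := by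
    have := A.card_add_card_compl
    rw [← hV] at this
    have : (A.card : ℝ) + Aᶜ.card = n := by exact_mod_cast this
    linarith
  obtain ⟨x, y, hxy, T, hTt, hT⟩ := contains_book_iff.1 hbook
  obtain ⟨f, hf⟩ : ∃ f, f = ∑ z ∈ A, oppositeNonadj G A z := ⟨_, rfl⟩
  obtain ⟨E, hE⟩ : ∃ E, E = ∑ x ∈ A, {y ∈ A | G.Adj x y}.card := ⟨_, rfl⟩
  have hlow : γ * n * t ≤ 8 * s * f := by
    rw [hf]
    refine mul_le_sum_oppositeNonadj (by omega) ht ?_ hcod (by positivity) ?_ ?_ hxy hT hTt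
    · exact fun x y hxy S T hS hT => hfree' x y hxy S T (by omega) (by omega)
    · rw [← mul_assoc, hγs, hAΔ']; nlinarith only [hβ, hn₁, hΔn, hn0]
    · rw [← mul_assoc, hγs, hB]; nlinarith
  have hmain : 2 * G.edgeFinset.card + f ≤ 2 * (A.card * Aᶜ.card) + E := by
    rw [hf, hE]
    exact two_mul_card_edgeFinset_add_le fun w => by rw [hAΔ, ← hncard]; exact hdeg w
  have hEf : (E : ℝ) ≤ f / 2 := by
    rcases le_or_gt (5 * t) Aᶜ.card with h5 | h5
    · have h1 : E * Aᶜ.card ≤ 2 * t * f + E * t := by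
        rw [hf, hE]
        refine sum_card_adj_mul_card_compl_le (fun x hx => ?_) hcod
        have := hcod v x ((hAv x).1 hx)
        rw [← Finset.coe_filter_univ, Set.ncard_coe_finset] at this
        refine (Finset.card_le_card fun y hy => ?_).trans this
        simpa [hAv] using hy
      have h2 : E * (5 * t) ≤ E * Aᶜ.card := Nat.mul_le_mul_left _ h5
      have h3 : t * (2 * E) ≤ t * f := by nlinarith
      have h4 : 2 * E ≤ f := Nat.le_of_mul_le_mul_left h3 ht
      have h5 : 2 * (E : ℝ) ≤ f := by exact_mod_cast h4
      linarith
    · have h5' : (n - Δ : ℝ) < 5 * t := by rw [← hB]; exact_mod_cast h5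
      have h1 : (E : ℝ) ≤ M * n + ε * n ^ 2 := by
        have := sum_card_adj_le_of_no_biclique (G := G) A (s := s) (M := M) (ε := ε) (by omega) hM
          (by rw [← hV]; omega) ?_
        · rw [← hV] at this
          rw [hE]; exact_mod_cast this
        intro S hS T hT hSs hTs
        by_contra! hST
        obtain ⟨w, hw⟩ : S.Nonempty := Finset.card_pos.1 (by omega)
        refine hfree' v w ((hAv w).1 (hS hw)) (S.erase w) T ?_ (by omega) ?_ (by simp)
          (fun z hz => (hAv z).1 (hT hz)) (hST w hw)
          fun u hu z hz => hST u (Finset.mem_of_mem_erase hu) z hz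
        · rw [Finset.card_erase_of_mem hw]; omega
        · exact fun h => G.loopless.irrefl v ((hAv v).1 (hS (Finset.mem_of_mem_erase h)))
      exact le_half_of_mul_le hs0 hγ0 hn0 hεs hn₂ (by linarith) hlow h1
  have hedge : G.edgeSet.ncard = G.edgeFinset.card := by
    rw [← G.coe_edgeFinset, Set.ncard_coe_finset]
  have hmain' : 2 * (G.edgeFinset.card : ℝ) + f ≤ 2 * (Δ * (n - Δ)) + E := by
    rw [← hB, ← hAΔ']
    exact_mod_cast hmain
  have hfinal : γ / (32 * s) * t * n ≤ f / 4 := by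
    rw [div_mul_eq_mul_div, div_mul_eq_mul_div, div_le_iff₀ (by positivity)]
    linarith
  rw [hedge]
  linarith

/-- for `F` 3-chromatic with a color-critical edge, an `F`-free graph on
`n` vertices with maximum degree `n/2 < Δ < βn` whose largest book is `B_t` (`t ≤ αn`)
has at most `Δ(n-Δ) - ctn` edges. -/
theorem book_bounded_edge_bound {U : Type*} [Fintype U] (α β : ℝ)
    (hβ : 1 / 2 < β) (hα0 : 0 < α) (hα : α < 1 / 9) (hαβ : 2 * α < 1 - β)
    (F : SimpleGraph U) (hchr : F.chromaticNumber = 3)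
    (hcc : ∃ e ∈ F.edgeSet, (F.deleteEdges {e}).chromaticNumber < F.chromaticNumber) :
    ∃ c : ℝ, 0 < c ∧ ∃ n₀ : ℕ, ∀ n ≥ n₀, ∀ t Δ : ℕ, 0 < t → 0 < Δ →
      (t : ℝ) ≤ α * n → (n : ℝ) / 2 < (Δ : ℝ) → (Δ : ℝ) < β * n →
      ∀ G : SimpleGraph (Fin n),
        ¬ Contains F G →
        (∀ v, (G.neighborSet v).ncard ≤ Δ) →
        (∃ v, (G.neighborSet v).ncard = Δ) →
        Contains (book t) G → ¬ Contains (book (t + 1)) G →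
        (G.edgeSet.ncard : ℝ) ≤ (Δ : ℝ) * ((n : ℝ) - (Δ : ℝ)) - c * t * n := by
  obtain ⟨a, b, hab, C, hCab, hC⟩ := exists_bicoloring_of_critical hchr hcc
  have hβ1 : 0 < 1 - β := by linarith
  obtain ⟨s, hs⟩ : ∃ s, s = Fintype.card U + 2 := ⟨_, rfl⟩
  have hs0 : (0 : ℝ) < s := by rw [hs]; positivity
  obtain ⟨γ, hγ⟩ : ∃ γ, γ = (1 - β) / (2 * s) := ⟨_, rfl⟩
  have hγ0 : 0 < γ := by rw [hγ]; positivity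
  have hγs : s * γ = (1 - β) / 2 := by rw [hγ]; field_simp
  obtain ⟨ε, hε⟩ : ∃ ε, ε = γ * (1 - β) / (160 * s) := ⟨_, rfl⟩
  have hε0 : 0 < ε := by rw [hε]; positivity
  have hεs : 160 * s * ε = γ * (1 - β) := by rw [hε]; field_simp
  obtain ⟨M, hM⟩ := exists_nat_ge (2 * s / ε)
  rw [div_le_iff₀ hε0] at hM
  obtain ⟨n₁, hn₁⟩ := exists_nat_ge ((8 * s + 4) / (1 - β))
  obtain ⟨n₂, hn₂⟩ := exists_nat_ge (M / ε)
  refine ⟨γ / (32 * s), by positivity, n₁ + n₂ + M * 2 ^ M * s + 1, ?_⟩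
  intro n hn t Δ ht _ _ hΔn hΔβ G hfree hdeg hmax hbook hbook'
  have hn₁' : 8 * s + 4 ≤ (1 - β) * n := by
    rw [div_le_iff₀ hβ1] at hn₁
    have : (n₁ : ℝ) ≤ n := by exact_mod_cast (by omega : n₁ ≤ n)
    nlinarith
  have hn₂' : M ≤ ε * n := by
    rw [div_le_iff₀ hε0] at hn₂
    have : (n₂ : ℝ) ≤ n := by exact_mod_cast (by omega : n₂ ≤ n)
    nlinarith
  exact ncard_edgeSet_le_of_book hab hCab hC (Fintype.card_fin n).symm hs hβ hγ0 hγs hεs hM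
    (by omega) hn₁' hn₂' ht hΔn hΔβ hfree hdeg hmax hbook hbook'
end
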